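/- arXiv:0901.1560 — 4 statements merged into one kernel-verified Lean document; each statement's English description precedes it below -/
import Mathlib

section
/- Let R be a commutative self FP-injective ring. Then R is coherent if and only if R is semicoherent. -/
universe u

/-- A ring is *coherent* if every finitely generated ideal is finitely presented. -/
def IsCoherentRing (R : Type u) [CommRing R] : Prop :=
  ∀ I : Ideal R, I.FG → Module.FinitePresentation R I

/-- A ring is *semicoherent* if `Hom_R(E, F)` is (isomorphic to) a submodule of a flat module
for every pair of injective modules `E`, `F`. -/
def IsSemicoherentRing (R : Type u) [CommRing R] : Prop :=
  ∀ (E F : Type u) [AddCommGroup E] [Module R E] [AddCommGroup F] [Module R F],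
    Module.Injective R E → Module.Injective R F →
      ∃ G : ModuleCat.{u} R, Module.Flat R G ∧
        ∃ i : (E →ₗ[R] F) →ₗ[R] G, Function.Injective i

/-- An `R`-module `E` is *FP-injective* if `Ext¹_R(F, E) = 0` for every finitely
presented `R`-module `F`. -/
def IsFPInjective (R : Type u) [CommRing R] (E : Type u) [AddCommGroup E] [Module R E] : Prop :=
  ∀ (F : Type u) [AddCommGroup F] [Module R F], Module.FinitePresentation R F →
    Subsingleton (((Ext R (ModuleCat.{u} R) 1).obj
      (Opposite.op (ModuleCat.of R F))).obj (ModuleCat.of R E))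

/-- A ring is an *IF-ring* if every injective module over it is flat. -/
def IsIFRing (R : Type u) [CommRing R] : Prop :=
  ∀ (M : Type u) [AddCommGroup M] [Module R M], Module.Injective R M → Module.Flat R M

/-- `f : M →ₗ[R] E` exhibits `E` as an injective hull of `M`: `E` is injective and
`f` embeds `M` as an essential submodule of `E`. -/
def IsInjectiveHull (R : Type u) [CommRing R] (M E : Type u) [AddCommGroup M] [Module R M]
    [AddCommGroup E] [Module R E] (f : M →ₗ[R] E) : Prop :=
  Module.Injective R E ∧ Function.Injective f ∧
    ∀ N : Submodule R E, N ≠ ⊥ → N ⊓ LinearMap.range f ≠ ⊥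

/-- A module is indecomposable if it is nonzero and not the direct sum
of two nonzero submodules. -/
def IsIndecomposableModule (R : Type u) [CommRing R] (M : Type u) [AddCommGroup M]
    [Module R M] : Prop :=
  Nontrivial M ∧ ∀ A B : Submodule R M, IsCompl A B → A = ⊥ ∨ B = ⊥

/-- A module has *finite Goldie dimension* if its injective hull is a finite direct
sum of indecomposable injective modules. -/
def HasFiniteGoldieDimension (R : Type u) [CommRing R] (M : Type u) [AddCommGroup M]
    [Module R M] : Prop :=
  ∃ (E : ModuleCat.{u} R) (f : M →ₗ[R] E), IsInjectiveHull R M E f ∧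
    ∃ (n : ℕ) (D : Fin n → Submodule R E), DirectSum.IsInternal D ∧
      ∀ i, Module.Injective R (D i) ∧ IsIndecomposableModule R (D i)

/-- A commutative ring is a *valuation ring* (uniserial) if its ideals are totally
ordered by inclusion. -/
def IsChainRing (R : Type u) [CommRing R] : Prop :=
  ∀ I J : Ideal R, I ≤ J ∨ J ≤ I

/-- A commutative ring is *arithmetical* if all its localizations at maximal ideals are
valuation rings. -/
def IsArithmetical (R : Type u) [CommRing R] : Prop :=
  ∀ (P : Ideal R) (hP : P.IsMaximal),
    haveI := hP.isPrime
    IsChainRing (Localization.AtPrime P)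

/-- An `R`-module `M` is *finitely injective* if every homomorphism `A → M` from a finitely
generated submodule `A` of an arbitrary module `B` extends to `B`. -/
def IsFinitelyInjective (R : Type u) [CommRing R] (M : Type u) [AddCommGroup M]
    [Module R M] : Prop :=
  ∀ (B : Type u) [AddCommGroup B] [Module R B] (A : Submodule R B), A.FG →
    ∀ f : A →ₗ[R] M, ∃ g : B →ₗ[R] M, ∀ a : A, g a = f a

/-- A domain has *finite character* if every nonzero element lies in only finitely many
maximal ideals. -/
def FiniteCharacter (R : Type u) [CommRing R] : Prop :=
  ∀ r : R, r ≠ 0 → {P : Ideal R | P.IsMaximal ∧ r ∈ P}.Finite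

open CategoryTheory in
/-- Vanishing of `Ext¹(P/A, M)` gives extensions of maps `A → M` to `P`. -/
theorem extend_of_ext_zero (R : Type u) [CommRing R] (M P : Type u) [AddCommGroup M] [Module R M]
    [AddCommGroup P] [Module R P] [Module.Projective R P] (A : Submodule R P)
    (h : Subsingleton (((Ext R (ModuleCat.{u} R) 1).obj
      (Opposite.op (ModuleCat.of R (P ⧸ A)))).obj (ModuleCat.of R M)))
    (f : A →ₗ[R] M) : ∃ g : P →ₗ[R] M, ∀ a : A, g a = f a := by
  let Q := projectiveResolution (ModuleCat.of R (P ⧸ A))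
  have hz : ((Q.complex.linearYonedaObj R (ModuleCat.of R M)).ExactAt 1) := by
    rw [HomologicalComplex.exactAt_iff_isZero_homology]
    refine Limits.IsZero.of_iso ?_ (Q.isoExt 1 (ModuleCat.of R M)).symm
    exact ModuleCat.isZero_of_subsingleton _
  rw [HomologicalComplex.exactAt_iff' _ 0 1 2 (by simp) (by simp),
    ShortComplex.moduleCat_exact_iff] at hz
  have hz' : ∀ c : Q.complex.X 1 ⟶ ModuleCat.of R M, Q.complex.d 2 1 ≫ c = 0 →
      ∃ b : Q.complex.X 0 ⟶ ModuleCat.of R M, Q.complex.d 1 0 ≫ b = c := by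
    intro c hc
    exact hz c hc
  have hex := Q.exact₀
  rw [ShortComplex.moduleCat_exact_iff] at hex
  let π : Q.complex.X 0 →ₗ[R] (P ⧸ A) := (Q.π.f 0).hom
  have hπ : Function.Surjective π := (ModuleCat.epi_iff_surjective (Q.π.f 0)).1 inferInstance
  have hex' : ∀ x : Q.complex.X 0, π x = 0 → ∃ y, (Q.complex.d 1 0).hom y = x := fun x hx => hex x hx
  have hdπ : ∀ y, π ((Q.complex.d 1 0).hom y) = 0 := fun y =>
    congrArg (fun t => t.hom y) Q.complex_d_comp_π_f_zero
  have hdd : ∀ y, (Q.complex.d 1 0).hom ((Q.complex.d 2 1).hom y) = 0 := fun y =>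
    congrArg (fun t => t.hom y) (Q.complex.d_comp_d 2 1 0)
  have : Module.Projective R (Q.complex.X 0) :=
    (IsProjective.iff_projective _).2 (Q.projective 0)
  obtain ⟨σ, hσ⟩ := Module.projective_lifting_property π A.mkQ hπ
  obtain ⟨τ, hτ⟩ := Module.projective_lifting_property A.mkQ π A.mkQ_surjective
  have hσ' : ∀ p, π (σ p) = A.mkQ p := fun p => LinearMap.congr_fun hσ p
  have hτ' : ∀ p, A.mkQ (τ p) = π p := fun p => LinearMap.congr_fun hτ p
  let c : Q.complex.X 1 →ₗ[R] A := (τ ∘ₗ (Q.complex.d 1 0).hom).codRestrict A (fun y => by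
    rw [← Submodule.Quotient.mk_eq_zero]
    exact (hτ' _).trans (hdπ y))
  obtain ⟨b, hb⟩ := hz' (ModuleCat.ofHom (f ∘ₗ c)) (by
    ext y
    have : c ((Q.complex.d 2 1).hom y) = 0 := by
      apply Subtype.ext
      change τ ((Q.complex.d 1 0).hom ((Q.complex.d 2 1).hom y)) = 0
      rw [hdd, map_zero]
    change f (c ((Q.complex.d 2 1).hom y)) = 0
    rw [this, map_zero])
  have hb' : ∀ y, b.hom ((Q.complex.d 1 0).hom y) = f (c y) := fun y =>
    congrArg (fun t => t.hom y) hb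
  let k : P →ₗ[R] A := (LinearMap.id - τ ∘ₗ σ).codRestrict A (fun p => by
    rw [← Submodule.Quotient.mk_eq_zero]
    change A.mkQ (p - τ (σ p)) = 0
    rw [map_sub, hτ', hσ', sub_self])
  refine ⟨f ∘ₗ k + b.hom ∘ₗ σ, fun a => ?_⟩
  obtain ⟨y, hy⟩ := hex' (σ a) (by rw [hσ']; simp)
  change f (k a) + b.hom (σ a) = f a
  rw [← hy, hb', ← map_add]
  congr 1
  apply Subtype.ext
  change ((a : P) - τ (σ a)) + τ ((Q.complex.d 1 0).hom y) = a
  rw [hy]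
  simp

/-- Maps into an injective module factor through any map with smaller kernel. -/
theorem factor_injective {R : Type u} [CommRing R] {A B F : Type u} [AddCommGroup A] [Module R A]
    [AddCommGroup B] [Module R B] [AddCommGroup F] [Module R F] (hF : Module.Injective R F)
    (g : A →ₗ[R] B) (f : A →ₗ[R] F) (h : ∀ a, g a = 0 → f a = 0) :
    ∃ k : B →ₗ[R] F, ∀ a, k (g a) = f a := by
  obtain ⟨k, hk⟩ := hF.out ((LinearMap.ker g).liftQ g le_rfl)
    (LinearMap.ker_eq_bot.1 (Submodule.ker_liftQ_eq_bot' _ _ rfl))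
    ((LinearMap.ker g).liftQ f (fun a ha => h a ha))
  exact ⟨k, fun a => hk (Submodule.Quotient.mk a)⟩

/-- Same for a self FP-injective ring, with finite modules. -/
theorem factor_self {R : Type u} [CommRing R] (hself : IsFPInjective R R) {A B : Type u}
    [AddCommGroup A] [Module R A] [AddCommGroup B] [Module R B] [Module.Finite R A]
    [Module.Finite R B] [Module.Free R B]
    (g : A →ₗ[R] B) (f : A →ₗ[R] R) (h : ∀ a, g a = 0 → f a = 0) :
    ∃ k : B →ₗ[R] R, ∀ a, k (g a) = f a := by
  have hfg : (LinearMap.range g).FG := Module.Finite.iff_fg.1 inferInstance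
  have hfp : Module.FinitePresentation R (B ⧸ LinearMap.range g) :=
    Module.finitePresentation_of_free_of_surjective (LinearMap.range g).mkQ
      (Submodule.mkQ_surjective _) (by rwa [Submodule.ker_mkQ])
  obtain ⟨k, hk⟩ := extend_of_ext_zero R R B (LinearMap.range g) (hself _ hfp)
    ((LinearMap.ker g).liftQ f (fun a ha => h a ha) ∘ₗ g.quotKerEquivRange.symm.toLinearMap)
  refine ⟨k, fun a => ?_⟩
  have := hk ⟨g a, a, rfl⟩
  rw [this]
  have e : g.quotKerEquivRange.symm ⟨g a, a, rfl⟩ = Submodule.Quotient.mk a := by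
    rw [LinearEquiv.symm_apply_eq]; rfl
  rw [LinearMap.comp_apply, LinearEquiv.coe_coe, e]
  exact Submodule.liftQ_apply _ _ _

theorem exists_injective_embedding (R : Type u) [CommRing R] (M : Type u) [AddCommGroup M]
    [Module R M] : ∃ (E : ModuleCat.{u} R) (i : M →ₗ[R] E), Module.Injective R E ∧
      Function.Injective i := by
  open CategoryTheory in
  refine ⟨Injective.under (ModuleCat.of R M), (Injective.ι (ModuleCat.of R M)).hom, ?_, ?_⟩
  · exact @Module.injective_module_of_injective_object R _ _ _ _
      (Injective.injective_under (ModuleCat.of R M))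
  · exact (ModuleCat.mono_iff_injective _).1 inferInstance

theorem semicoherent_of_coherent (R : Type u) [CommRing R] (hR : IsCoherentRing R) :
    IsSemicoherentRing R := by
  intro E F _ _ _ _ hE hF
  refine ⟨ModuleCat.of R (E →ₗ[R] F), ?_, LinearMap.id, Function.injective_id⟩
  change Module.Flat R (E →ₗ[R] F)
  refine Module.Flat.of_forall_isTrivialRelation ?_
  intro l f x hfx
  let p : (Fin l → R) →ₗ[R] R := Fintype.linearCombination R f
  have hp : ∀ r, p r = ∑ i, r i * f i := fun r => by
    simp [p, Fintype.linearCombination_apply]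
  have : Module.FinitePresentation R (LinearMap.range p) :=
    hR (LinearMap.range p) (Module.Finite.iff_fg.1 inferInstance)
  have hker : (LinearMap.ker p).FG := by
    have := Module.FinitePresentation.fg_ker p.rangeRestrict p.surjective_rangeRestrict
    rwa [LinearMap.ker_rangeRestrict] at this
  obtain ⟨k, b, hb⟩ := Submodule.fg_iff_exists_fin_generating_family.1 hker
  let T : (Fin l → E) →ₗ[R] (Fin k → E) :=
    LinearMap.pi fun j => ∑ i, b j i • LinearMap.proj i
  have hT : ∀ e j, T e j = ∑ i, b j i • e i := fun e j => by simp [T]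
  let Φ : (Fin l → E) →ₗ[R] F := ∑ i, x i ∘ₗ LinearMap.proj i
  have hΦ : ∀ e, Φ e = ∑ i, x i (e i) := fun e => by simp [Φ]
  obtain ⟨H, hH⟩ := factor_injective hF T Φ (by
    intro e he
    obtain ⟨h, hh⟩ := factor_injective hE p (Fintype.linearCombination R e) (by
      have : LinearMap.ker p ≤ LinearMap.ker (Fintype.linearCombination R e) := by
        rw [← hb, Submodule.span_le]
        rintro _ ⟨j, rfl⟩
        have := congrFun he j
        rw [hT] at this
        simpa [Fintype.linearCombination_apply] using this
      exact fun a ha => this ha)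
    have he' : ∀ i, e i = f i • h 1 := by
      intro i
      have := hh (Pi.single i 1)
      rw [← map_smul, smul_eq_mul, mul_one]
      simpa [p] using this.symm
    rw [hΦ]
    have := LinearMap.congr_fun hfx (h 1)
    simpa [he'] using this)
  refine ⟨k, fun i j => b j i, fun j => H ∘ₗ LinearMap.single R (fun _ => E) j, fun i => ?_,
    fun j => ?_⟩
  · ext e
    have h1 := hH (Pi.single i e)
    have h2 : T (Pi.single i e) = ∑ j, b j i • (Pi.single j e : Fin k → E) := by
      ext j
      rw [hT]
      simp [Pi.single_apply, Finset.sum_apply]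
    have h3 : Φ (Pi.single i e) = x i e := by
      rw [hΦ, Finset.sum_eq_single i]
      · simp
      · intro i' _ hi'; simp [hi']
      · simp
    rw [← h3, ← h1, h2]
    simp [map_sum]
  · have : b j ∈ LinearMap.ker p := hb ▸ Submodule.subset_span ⟨j, rfl⟩
    rw [LinearMap.mem_ker, hp] at this
    simpa [mul_comm] using this

theorem coherent_of_semicoherent (R : Type u) [CommRing R] (hself : IsFPInjective R R)
    (hR : IsSemicoherentRing R) : IsCoherentRing R := by
  intro I hI
  obtain ⟨n, a, ha⟩ := Submodule.fg_iff_exists_fin_generating_family.1 hI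
  -- the submodule generated by the vector `a`
  let C := (Fin n → R) ⧸ Submodule.span R {a}
  obtain ⟨F, c, hF, hc⟩ := exists_injective_embedding R C
  obtain ⟨E, ι, hE, hι⟩ := exists_injective_embedding R R
  let aE : E →ₗ[R] (Fin n → E) := LinearMap.pi fun i => a i • LinearMap.id
  let u : (Fin n → R) →ₗ[R] (Fin n → E) ⧸ LinearMap.range aE :=
    (LinearMap.range aE).mkQ ∘ₗ LinearMap.pi fun i => ι ∘ₗ LinearMap.proj i
  let v : (Fin n → R) →ₗ[R] F := c ∘ₗ (Submodule.span R {a}).mkQ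
  have hv0 : ∀ r, v r = 0 ↔ ∃ s : R, s • a = r := by
    intro r
    rw [← Submodule.mem_span_singleton, ← Submodule.Quotient.mk_eq_zero]
    exact map_eq_zero_iff c hc
  obtain ⟨w, hw⟩ := factor_injective hF u v (by
    intro r hr
    obtain ⟨e, he⟩ := (Submodule.Quotient.mk_eq_zero _).1 hr
    have he' : ∀ i, a i • e = ι (r i) := fun i => congrFun he i
    obtain ⟨k, hk⟩ := factor_self hself (Fintype.linearCombination R a)
      (Fintype.linearCombination R r) (by
        intro s hs
        apply hι
        rw [Fintype.linearCombination_apply] at hs ⊢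
        simp only [map_sum, map_smul, map_zero, ← he', smul_smul]
        rw [← Finset.sum_smul]
        simp only [smul_eq_mul] at hs
        rw [hs, zero_smul])
    rw [hv0]
    refine ⟨k 1, ?_⟩
    ext i
    have := hk (Pi.single i 1)
    simp only [Fintype.linearCombination_apply_single, one_smul] at this
    rw [← this, Pi.smul_apply, smul_eq_mul, mul_comm, ← smul_eq_mul, ← map_smul]
    simp)
  let φ : Fin n → (E →ₗ[R] F) := fun i =>
    w ∘ₗ (LinearMap.range aE).mkQ ∘ₗ LinearMap.single R (fun _ => E) i
  have hφ : ∀ r : Fin n → R, ∑ i, r i • φ i (ι 1) = v r := by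
    intro r
    rw [← hw]
    simp only [φ, u, LinearMap.comp_apply, ← map_smul, ← map_sum]
    congr 2
    ext i
    simp [Finset.sum_apply, Pi.single_apply]
  have hφa : ∑ i, a i • φ i = 0 := by
    ext e
    simp only [φ, LinearMap.sum_apply, LinearMap.smul_apply, LinearMap.comp_apply, ← map_smul,
      ← map_sum]
    have : (∑ i, a i • (LinearMap.single R (fun _ => E) i) e) = aE e := by
      ext i
      simp [aE, Finset.sum_apply, Pi.single_apply]
    have h0 : (LinearMap.range aE).mkQ (aE e) = 0 := by simp
    simp only [← map_smul] at this
    rw [this, h0]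
    simp
  obtain ⟨G, hG, j, hj⟩ := hR E F hE hF
  have hrel : ∑ i, a i • j (φ i) = 0 := by
    simp only [← map_smul, ← map_sum, hφa, map_zero]
  obtain ⟨m, b, y, hby, hab⟩ := Module.Flat.isTrivialRelation_of_sum_smul_eq_zero hrel
  let B : (Fin n → R) →ₗ[R] (Fin m → R) := Fintype.linearCombination R b
  have hB : ∀ r, B r = 0 → ∃ s : R, s • a = r := by
    intro r hr
    rw [← hv0, ← hφ]
    have h1 : ∑ i, r i • φ i = 0 := by
      apply hj
      simp only [map_sum, map_smul, map_zero, hby, Finset.smul_sum, smul_smul]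
      rw [Finset.sum_comm]
      refine Finset.sum_eq_zero fun t _ => ?_
      rw [← Finset.sum_smul]
      have := congrFun hr t
      simp only [B, Fintype.linearCombination_apply, Finset.sum_apply, Pi.smul_apply,
        smul_eq_mul, Pi.zero_apply] at this
      rw [this, zero_smul]
    simpa using LinearMap.congr_fun h1 (ι 1)
  -- the relation module of `a` is generated by the columns of `b`
  let q : (Fin n → R) →ₗ[R] R := Fintype.linearCombination R a
  have hq : ∀ s, q s = ∑ i, s i * a i := fun s => by simp [q, Fintype.linearCombination_apply]
  have hker : LinearMap.ker q = Submodule.span R (Set.range fun t : Fin m => fun i => b i t) := by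
    apply le_antisymm
    · intro s hs
      rw [LinearMap.mem_ker, hq] at hs
      obtain ⟨k, hk⟩ := factor_self hself B (Fintype.linearCombination R s) (by
        intro r hr
        obtain ⟨z, rfl⟩ := hB r hr
        simp only [Fintype.linearCombination_apply, Pi.smul_apply, smul_eq_mul, mul_assoc]
        rw [← Finset.mul_sum]
        simp only [mul_comm (a _), hs, mul_zero])
      have hs' : s = ∑ t, k (Pi.single t 1) • (fun i => b i t) := by
        ext i
        have := hk (Pi.single i 1)
        simp only [B, Fintype.linearCombination_apply_single, one_smul] at this
        rw [← this]
        conv_lhs => rw [pi_eq_sum_univ' (b i)]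
        simp [map_sum, Finset.sum_apply, mul_comm]
      rw [hs']
      exact Submodule.sum_mem _ fun t _ =>
        Submodule.smul_mem _ _ (Submodule.subset_span ⟨t, rfl⟩)
    · rw [Submodule.span_le]
      rintro _ ⟨t, rfl⟩
      change q _ = 0
      rw [hq]
      simpa [mul_comm] using hab t
  have hrange : LinearMap.range q = I := by
    rw [← ha]; exact Fintype.range_linearCombination R a
  rw [← hrange]
  refine Module.finitePresentation_of_free_of_surjective q.rangeRestrict
    q.surjective_rangeRestrict ?_
  rw [LinearMap.ker_rangeRestrict, hker]
  exact Submodule.fg_span (Set.finite_range _)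

/-- Let `R` be a commutative self FP-injective ring. Then `R` is coherent
if and only if `R` is semicoherent. -/
theorem coherent_iff_semicoherent_of_selfFPInjective (R : Type u) [CommRing R]
    (hself : IsFPInjective R R) :
    IsCoherentRing R ↔ IsSemicoherentRing R :=
  ⟨semicoherent_of_coherent R, coherent_of_semicoherent R hself⟩
end

section
/- Let R be a commutative ring which is self FP-injective and semicoherent. Then R is an IF-ring, i.e., every injective R-module is flat (indeed every injective R-module is a direct summand of a flat R-module). -/
universe u

section Helpers

open CategoryTheory TensorProduct

/-- Vanishing of `Ext¹(F, Y)` means that 1-cocycles on a projective resolution are coboundaries. -/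
lemma exists_of_ext_subsingleton {R : Type u} [CommRing R] {X Y : ModuleCat.{u} R}
    (P : CategoryTheory.ProjectiveResolution X)
    (h : Subsingleton (((Ext R (ModuleCat.{u} R) 1).obj (Opposite.op X)).obj Y))
    (c : P.complex.X 1 →ₗ[R] Y) (hc : c ∘ₗ (P.complex.d 2 1).hom = 0) :
    ∃ b : P.complex.X 0 →ₗ[R] Y, c = b ∘ₗ (P.complex.d 1 0).hom := by
  have hz : CategoryTheory.Limits.IsZero ((P.complex.linearYonedaObj R Y).homology 1) :=
    (ModuleCat.isZero_of_subsingleton _).of_iso (P.isoExt 1 Y).symm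
  rw [← HomologicalComplex.exactAt_iff_isZero_homology,
    HomologicalComplex.exactAt_iff' _ 0 1 2 (by simp) (by simp),
    CategoryTheory.ShortComplex.moduleCat_exact_iff] at hz
  obtain ⟨b, hb⟩ := hz (ModuleCat.ofHom c) (by
    change P.complex.d 2 1 ≫ ModuleCat.ofHom c = 0
    ext x
    exact LinearMap.congr_fun hc x)
  have hb' : P.complex.d 1 0 ≫ b = ModuleCat.ofHom c := hb
  refine ⟨b.hom, ?_⟩
  have := congrArg ModuleCat.Hom.hom hb'
  exact this.symm

lemma selfFPInjective_extend {R : Type u} [CommRing R] (hself : IsFPInjective R R) {n : ℕ}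
    (K : Submodule R (Fin n → R)) (hK : K.FG) (f : K →ₗ[R] R) :
    ∃ g : (Fin n → R) →ₗ[R] R, ∀ k : K, g k = f k := by
  have hfp : Module.FinitePresentation R ((Fin n → R) ⧸ K) :=
    Module.finitePresentation_of_surjective K.mkQ K.mkQ_surjective (by simpa using hK)
  have hE := hself _ hfp
  let P := CategoryTheory.projectiveResolution (ModuleCat.of R ((Fin n → R) ⧸ K))
  let d := (P.complex.d 1 0).hom
  let e : P.complex.X 0 →ₗ[R] ((Fin n → R) ⧸ K) := (P.π.f 0).hom
  have he : Function.Surjective e :=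
    (ModuleCat.epi_iff_surjective (P.π.f 0)).1 inferInstance
  have hed : ∀ x, e (d x) = 0 := fun x =>
    LinearMap.congr_fun (congrArg ModuleCat.Hom.hom P.complex_d_comp_π_f_zero) x
  have hex : ∀ y, e y = 0 → ∃ x, d x = y := by
    have := CategoryTheory.ShortComplex.exact_of_g_is_cokernel
      (CategoryTheory.ShortComplex.mk _ _ P.complex_d_comp_π_f_zero) P.isColimitCokernelCofork
    rw [CategoryTheory.ShortComplex.moduleCat_exact_iff] at this
    exact this
  have hproj : Module.Projective R (P.complex.X 0) :=
    (IsProjective.iff_projective _).2 (P.projective 0)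
  obtain ⟨g0, hg0⟩ := Module.projective_lifting_property K.mkQ e K.mkQ_surjective
  obtain ⟨t, ht⟩ := Module.projective_lifting_property e K.mkQ he
  have hg0' : ∀ x, K.mkQ (g0 x) = e x := fun x => LinearMap.congr_fun hg0 x
  have ht' : ∀ x, e (t x) = K.mkQ x := fun x => LinearMap.congr_fun ht x
  have h1 : ∀ x, g0 (d x) ∈ K := fun x => by
    rw [← Submodule.Quotient.mk_eq_zero, ← Submodule.mkQ_apply, hg0', hed]
  have h2 : ∀ x, g0 (t x) - x ∈ K := fun x => by
    rw [← Submodule.Quotient.mk_eq_zero, ← Submodule.mkQ_apply, map_sub, hg0', ht', sub_self]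
  let g1 := (g0 ∘ₗ d).codRestrict K h1
  let q := (g0 ∘ₗ t - LinearMap.id).codRestrict K h2
  obtain ⟨b, hb⟩ := exists_of_ext_subsingleton P hE (f ∘ₗ g1) (by
    ext x
    have : d ((P.complex.d 2 1).hom x) = 0 :=
      LinearMap.congr_fun (congrArg ModuleCat.Hom.hom (P.complex.d_comp_d 2 1 0)) x
    have h3 : g1 ((P.complex.d 2 1).hom x) = 0 := by
      apply Subtype.ext
      change g0 (d _) = 0
      rw [this, map_zero]
    change f (g1 ((P.complex.d 2 1).hom x)) = 0
    rw [h3, map_zero])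
  refine ⟨b ∘ₗ t - f ∘ₗ q, fun k => ?_⟩
  obtain ⟨x, hx⟩ := hex (t k) (by rw [ht']; simp)
  have h4 : b (t k) = f (g1 x) := by
    rw [← hx]; exact (LinearMap.congr_fun hb x).symm
  have h5 : q k = g1 x - k := by
    apply Subtype.ext
    change g0 (t k) - k = g0 (d x) - k
    rw [hx]
  simp only [LinearMap.sub_apply, LinearMap.comp_apply, h5, map_sub]
  erw [h4]
  abel

lemma selfFPInjective_pure {R : Type u} [CommRing R] (hself : IsFPInjective R R)
    {H M : Type u} [AddCommGroup H] [Module R H] [AddCommGroup M] [Module R M]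
    (i : R →ₗ[R] H) (hi : Function.Injective i) (c : M)
    (hc : (i 1) ⊗ₜ[R] c = 0) : c = 0 := by
  have hP : (Submodule.span R {i 1}).FG := Submodule.fg_span_singleton _
  obtain ⟨Q, hPQ, hQ, h0⟩ := TensorProduct.eq_zero_of_fg_of_subtype_eq_zero (N := M) hP
    (t := (⟨i 1, Submodule.mem_span_singleton_self _⟩ : Submodule.span R {i 1}) ⊗ₜ[R] c)
    (by simpa using hc)
  let q0 : Q := ⟨i 1, hPQ (Submodule.mem_span_singleton_self _)⟩
  have h0' : q0 ⊗ₜ[R] c = 0 := h0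
  haveI : Module.Finite R Q := Module.Finite.iff_fg.2 hQ
  obtain ⟨n, p, hp⟩ := Module.Finite.exists_fin (R := R) (M := Q)
  obtain ⟨k, a, y, hy, ha⟩ := TensorProduct.vanishesTrivially_of_sum_tmul_eq_zero R
    (m := (Fin.cons q0 p : Fin (n + 1) → Q)) (n := (Fin.cons c 0 : Fin (n + 1) → M))
    (by
      rw [eq_top_iff, ← hp, Fin.range_cons]
      exact Submodule.span_mono (Set.subset_insert _ _))
    (by simp [Fin.sum_univ_succ, h0'])
  have hc0 : c = ∑ j, a 0 j • y j := by simpa using hy 0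
  have hcs : ∀ l : Fin n, ∑ j, a l.succ j • y j = 0 := fun l => by simpa using (hy l.succ).symm
  have ha' : ∀ j, a 0 j • i 1 + ∑ l : Fin n, a l.succ j • (p l : H) = 0 := fun j => by
    have := congrArg Subtype.val (ha j)
    simpa [Fin.sum_univ_succ, q0] using this
  let v : Fin k → (Fin n → R) := fun j l => a l.succ j
  let K := Submodule.span R (Set.range v)
  let G : (Fin n → R) →ₗ[R] H := Fintype.linearCombination R (fun l => (p l : H))
  have hGv : ∀ j, G (v j) = i (- a 0 j) := fun j => by
    have h6 : i (- a 0 j) = - (a 0 j • i 1) := by rw [← map_smul, ← map_neg]; simp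
    rw [h6, eq_neg_iff_add_eq_zero, add_comm]
    simpa [G, Fintype.linearCombination_apply, v] using ha' j
  have hGK : ∀ x : K, G x ∈ LinearMap.range i := fun x => by
    have : K ≤ (LinearMap.range i).comap G := by
      rw [Submodule.span_le]
      rintro _ ⟨j, rfl⟩
      exact ⟨_, (hGv j).symm⟩
    exact this x.2
  let f : K →ₗ[R] R := (LinearEquiv.ofInjective i hi).symm.toLinearMap ∘ₗ
    (G ∘ₗ K.subtype).codRestrict (LinearMap.range i) hGK
  have hf : ∀ x : K, i (f x) = G x := fun x => by
    have := (LinearEquiv.ofInjective i hi).apply_symm_apply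
      ((G ∘ₗ K.subtype).codRestrict (LinearMap.range i) hGK x)
    exact congrArg Subtype.val this
  obtain ⟨g, hg⟩ := selfFPInjective_extend hself K (Submodule.fg_span (Set.finite_range v)) f
  have hgv : ∀ j, g (v j) = - a 0 j := fun j => by
    have h7 := hg ⟨v j, Submodule.subset_span ⟨j, rfl⟩⟩
    apply hi
    rw [← hGv j]
    exact (congrArg i h7).trans (hf _)
  have hgv' : ∀ j, a 0 j = - ∑ l, a l.succ j * g (Pi.single l 1) := fun j => by
    rw [← neg_eq_iff_eq_neg, ← hgv j, LinearMap.pi_apply_eq_sum_univ g (v j)]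
    refine Finset.sum_congr rfl fun l _ => ?_
    rw [smul_eq_mul]
    congr 2
    ext m
    simp [Pi.single_apply, eq_comm]
  rw [hc0]
  calc ∑ j, a 0 j • y j = - ∑ j, ∑ l, g (Pi.single l 1) • a l.succ j • y j := by
        rw [← Finset.sum_neg_distrib]
        refine Finset.sum_congr rfl fun j _ => ?_
        rw [hgv' j, neg_smul, Finset.sum_smul]
        simp only [mul_smul, smul_comm (a _ j)]
    _ = 0 := by
        rw [Finset.sum_comm]
        simp only [← Finset.smul_sum, hcs]
        simp

lemma exists_embedding_injective (R : Type u) [CommRing R] :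
    ∃ (H : ModuleCat.{u} R) (i : R →ₗ[R] H), Module.Injective R H ∧ Function.Injective i := by
  let J := CategoryTheory.Injective.under (ModuleCat.of R R)
  haveI : CategoryTheory.Injective (ModuleCat.of R J) :=
    inferInstanceAs (CategoryTheory.Injective J)
  exact ⟨J, (CategoryTheory.Injective.ι (ModuleCat.of R R)).hom,
    Module.injective_module_of_injective_object R J,
    (ModuleCat.mono_iff_injective _).1 inferInstance⟩

lemma summand_of_flat {R : Type u} [CommRing R]
    (hself : IsFPInjective R R) (hsc : IsSemicoherentRing R)
    (M : Type u) [AddCommGroup M] [Module R M] (hM : Module.Injective R M) :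
    ∃ F : ModuleCat.{u} R, Module.Flat R F ∧
      ∃ (i : M →ₗ[R] F) (p : F →ₗ[R] M), p.comp i = LinearMap.id := by
  obtain ⟨H, i, hH, hi⟩ := exists_embedding_injective R
  have hinj : Function.Injective (TensorProduct.mk R H M (i 1)) := by
    rw [injective_iff_map_eq_zero]
    exact fun c hc => selfFPInjective_pure hself i hi c hc
  obtain ⟨φ, hφ⟩ := hM.out (TensorProduct.mk R H M (i 1)) hinj LinearMap.id
  let s : M →ₗ[R] (H →ₗ[R] M) := (TensorProduct.curry φ).flip
  have hs : Function.Injective s := fun x y hxy => by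
    have h1 := LinearMap.congr_fun hxy (i 1)
    have h2 : φ (i 1 ⊗ₜ x) = φ (i 1 ⊗ₜ y) := h1
    exact (hφ x).symm.trans (h2.trans (hφ y))
  obtain ⟨F, hF, j, hj⟩ := hsc H M hH hM
  obtain ⟨p, hp⟩ := hM.out (j ∘ₗ s) (hj.comp hs) LinearMap.id
  exact ⟨F, hF, j ∘ₗ s, p, LinearMap.ext hp⟩

end Helpers

/-- A self FP-injective semicoherent commutative ring is an IF-ring:
every injective module is flat, indeed a direct summand of a flat module. -/
theorem isIFRing_of_selfFPInjective_of_semicoherent (R : Type u) [CommRing R]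
    (hself : IsFPInjective R R) (hsc : IsSemicoherentRing R) :
    IsIFRing R ∧
      ∀ (M : Type u) [AddCommGroup M] [Module R M], Module.Injective R M →
        ∃ F : ModuleCat.{u} R, Module.Flat R F ∧
          ∃ (i : M →ₗ[R] F) (p : F →ₗ[R] M), p.comp i = LinearMap.id := by
  refine ⟨fun M _ _ hM => ?_, fun M _ _ hM => summand_of_flat hself hsc M hM⟩
  obtain ⟨F, hF, i, p, h⟩ := summand_of_flat hself hsc M hM
  exact Module.Flat.of_retract i p h
end

section
/- Let R be a valuation ring and let Z denote its set of zerodivisors, which is a prime ideal of R. Assume Z ≠ 0. Then the following conditions are equivalent: (1) R is semicoherent; (2) the localization R_Z is an IF-ring; (3) Z is not a flat R-module. -/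
universe u

namespace SemicoherentAux

variable {A : Type u} [CommRing A]

lemma chain_elt (hv : IsChainRing A) (x y : A) : (∃ t, x = y * t) ∨ (∃ t, y = x * t) := by
  rcases hv (Ideal.span {x}) (Ideal.span {y}) with h | h
  · left
    have := Ideal.mem_span_singleton.1 (h (Ideal.mem_span_singleton_self x))
    exact this
  · right
    have := Ideal.mem_span_singleton.1 (h (Ideal.mem_span_singleton_self y))
    exact this

lemma isBezout (hv : IsChainRing A) : IsBezout A := by
  rw [IsBezout.iff_span_pair_isPrincipal]
  intro x y
  rw [Ideal.span_insert]
  rcases hv (Ideal.span {x}) (Ideal.span {y}) with h | h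
  · rw [sup_eq_right.2 h]; exact ⟨⟨y, rfl⟩⟩
  · rw [sup_eq_left.2 h]; exact ⟨⟨x, rfl⟩⟩

open TensorProduct in
/-- A sufficient condition for flatness over a valuation ring. -/
lemma flat_of_chain (hv : IsChainRing A) (M : Type u) [AddCommGroup M] [Module A M]
    (h : ∀ (a : A) (m : M), a • m = 0 → ∃ (b : A) (m' : M), a * b = 0 ∧ m = b • m') :
    Module.Flat A M := by
  rw [Module.Flat.iff_rTensor_injective]
  intro I hI
  haveI := isBezout hv
  obtain ⟨r, rfl⟩ := (IsBezout.isPrincipal_of_FG I hI).principal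
  have hr : r ∈ Submodule.span A {r} := Submodule.mem_span_singleton_self r
  have key : ∀ x : (Submodule.span A {r} : Submodule A A) ⊗[A] M,
      ∃ m : M, x = (⟨r, hr⟩ : (Submodule.span A {r} : Submodule A A)) ⊗ₜ[A] m := by
    intro x
    induction x using TensorProduct.induction_on with
    | zero => exact ⟨0, by simp⟩
    | tmul i m =>
      obtain ⟨i, hi⟩ := i
      obtain ⟨c, rfl⟩ := Submodule.mem_span_singleton.1 hi
      refine ⟨c • m, ?_⟩
      rw [TensorProduct.tmul_smul, TensorProduct.smul_tmul']
      rfl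
    | add x y hx hy =>
      obtain ⟨m, rfl⟩ := hx
      obtain ⟨n, rfl⟩ := hy
      exact ⟨m + n, by rw [TensorProduct.tmul_add]⟩
  rw [injective_iff_map_eq_zero]
  intro x hx
  obtain ⟨m, rfl⟩ := key x
  have h0 : r • m = 0 := by
    have := congrArg (TensorProduct.lid A M) hx
    simpa using this
  obtain ⟨b, m', hb, rfl⟩ := h r m h0
  rw [TensorProduct.tmul_smul, TensorProduct.smul_tmul']
  have : b • (⟨r, hr⟩ : (Submodule.span A {r} : Submodule A A)) = 0 := by
    ext
    simpa [mul_comm] using hb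
  rw [this, TensorProduct.zero_tmul]

lemma chain_of_flat (hv : IsChainRing A) (M : Type u) [AddCommGroup M] [Module A M]
    [Module.Flat A M] (a : A) (m : M) (h : a • m = 0) :
    ∃ (b : A) (m' : M), a * b = 0 ∧ m = b • m' := by
  obtain ⟨k, c, y, h1, h2⟩ := Module.Flat.isTrivialRelation_of_sum_smul_eq_zero
    (ι := Unit) (f := fun _ => a) (x := fun _ => m) (by simpa using h)
  have h2' : ∀ j, a * c () j = 0 := fun j => by simpa using h2 j
  rw [show m = _ from h1 ()]
  refine Finset.sum_induction _ (fun m => ∃ (b : A) (m' : M), a * b = 0 ∧ m = b • m') ?_ ?_ ?_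
  · rintro _ _ ⟨b, m, hb, rfl⟩ ⟨b', m', hb', rfl⟩
    rcases chain_elt hv b b' with ⟨t, rfl⟩ | ⟨t, rfl⟩
    · exact ⟨b', t • m + m', hb', by rw [smul_add, mul_smul]⟩
    · exact ⟨b, m + t • m', hb, by rw [smul_add, mul_smul]⟩
  · exact ⟨0, 0, by simp, by simp⟩
  · intro j _
    exact ⟨c () j, y j, h2' j, rfl⟩

lemma exists_inj (M : Type u) [AddCommGroup M] [Module A M] :
    ∃ E : ModuleCat.{u} A, Module.Injective A E ∧ ∃ i : M →ₗ[A] E, Function.Injective i := by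
  let X := CategoryTheory.Injective.under (ModuleCat.of A M)
  refine ⟨X, ?_, (CategoryTheory.Injective.ι (ModuleCat.of A M)).hom, ?_⟩
  · exact (Module.injective_iff_injective_object A X).2
      (inferInstanceAs (CategoryTheory.Injective (CategoryTheory.Injective.under _)))
  · exact (ModuleCat.mono_iff_injective _).1 inferInstance

lemma divide {E : Type u} [AddCommGroup E] [Module A E] (hE : Module.Injective A E)
    (b : A) (e : E) (h : ∀ c : A, b * c = 0 → c • e = 0) : ∃ e' : E, e = b • e' := by
  let f := LinearMap.toSpanSingleton A A b
  let g : (A ⧸ LinearMap.ker f) →ₗ[A] E :=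
    (LinearMap.ker f).liftQ (LinearMap.toSpanSingleton A E e) (by
      intro c hc
      have : c * b = 0 := by simpa [f] using hc
      simpa using h c (by rw [mul_comm]; exact this))
  obtain ⟨φ, hφ⟩ := hE.out ((LinearMap.ker f).liftQ f le_rfl)
    (LinearMap.ker_eq_bot.1 (Submodule.ker_liftQ_eq_bot _ _ _ le_rfl)) g
  refine ⟨φ 1, ?_⟩
  have := hφ ((LinearMap.ker f).mkQ 1)
  simp only [Submodule.mkQ_apply, Submodule.liftQ_apply, g, f,
    LinearMap.toSpanSingleton_apply, one_smul] at this
  rw [← this, ← map_smul, smul_eq_mul, mul_one]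

variable {Z : Ideal A}

lemma cancel (hZcar : ∀ r : A, r ∈ Z ↔ r ∉ nonZeroDivisors A)
    {s x : A} (hs : s ∉ Z) (h : s * x = 0) : x = 0 := by
  have : s ∈ nonZeroDivisors A := by
    by_contra hh
    exact hs ((hZcar s).2 hh)
  exact (mul_left_mem_nonZeroDivisors_eq_zero_iff this).1 h

lemma exists_zd (hZcar : ∀ r : A, r ∈ Z ↔ r ∉ nonZeroDivisors A)
    {s : A} (hs : s ∈ Z) : ∃ d, d ≠ 0 ∧ d * s = 0 := by
  have := (hZcar s).1 hs
  rw [mem_nonZeroDivisors_iff_right] at this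
  push Not at this
  obtain ⟨d, h1, h2⟩ := this
  exact ⟨d, h2, h1⟩

/-- Double annihilators of principal ideals. -/
lemma double_ann (hZcar : ∀ r : A, r ∈ Z ↔ r ∉ nonZeroDivisors A)
    (hv : IsChainRing A) (hp : Z.IsPrime) {a c : A} (ha : a ≠ 0)
    (h : ∀ x, a * x = 0 → c * x = 0) : ∃ s, s ∉ Z ∧ ∃ y, s * c = a * y := by
  rcases chain_elt hv c a with ⟨t, rfl⟩ | ⟨t, rfl⟩
  · exact ⟨1, hp.one_notMem, t, by ring⟩
  · by_cases ht : t ∈ Z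
    · exfalso
      obtain ⟨d, hd, hdt⟩ := exists_zd hZcar ht
      rcases chain_elt hv d c with ⟨e, rfl⟩ | ⟨e, rfl⟩
      · exact hd (h e (by linear_combination hdt))
      · exact ha (by linear_combination e * hdt)
    · exact ⟨t, ht, 1, by ring⟩

lemma one_three (hZcar : ∀ r : A, r ∈ Z ↔ r ∉ nonZeroDivisors A)
    (hv : IsChainRing A) (hp : Z.IsPrime) (hZ0 : Z ≠ ⊥)
    (hs : IsSemicoherentRing A) : ¬ Module.Flat A Z := by
  intro hflat
  obtain ⟨a, haZ, ha⟩ := Submodule.exists_mem_ne_zero_of_ne_bot hZ0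
  obtain ⟨E, hE, j, hj⟩ := exists_inj (A := A) A
  let N : Submodule A E := LinearMap.range (LinearMap.lsmul A E a)
  obtain ⟨F, hF, i, hi⟩ := exists_inj (A := A) (E ⧸ N)
  obtain ⟨G, hG, k, hk⟩ := hs E F hE hF
  let h : E →ₗ[A] F := i ∘ₗ N.mkQ
  have hah : a • h = 0 := by
    ext e
    have : N.mkQ (a • e) = 0 := by
      rw [Submodule.mkQ_apply, Submodule.Quotient.mk_eq_zero]
      exact ⟨e, rfl⟩
    simp only [LinearMap.smul_apply, LinearMap.zero_apply, h, LinearMap.comp_apply]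
    rw [← map_smul, ← map_smul, this, map_zero]
  obtain ⟨b, g, hab, hbg⟩ := chain_of_flat hv G a (k h) (by rw [← map_smul, hah, map_zero])
  obtain ⟨c, z, hbc, hz⟩ := chain_of_flat hv Z b ⟨a, haZ⟩
    (by ext; simpa [mul_comm] using hab)
  have hz' : a = c * z := congrArg Subtype.val hz
  have hch : c • h = 0 := by
    apply hk
    rw [map_smul, hbg, smul_smul, mul_comm, hbc, zero_smul, map_zero]
  have h1 : N.mkQ (c • j 1) = 0 := by
    apply hi
    rw [map_smul, map_smul, map_zero]
    exact LinearMap.congr_fun hch (j 1)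
  rw [Submodule.mkQ_apply, Submodule.Quotient.mk_eq_zero] at h1
  obtain ⟨e, he⟩ := h1
  have he' : a • e = c • j 1 := he
  obtain ⟨s, hsZ, y, hy⟩ := double_ann hZcar hv hp (c := c) ha (by
    intro x hx
    apply hj
    have : x • (c • j 1) = 0 := by
      rw [← he', smul_smul, mul_comm, hx, zero_smul]
    rw [map_zero, ← this, ← map_smul, ← map_smul]
    congr 1
    simp [mul_comm])
  apply ha
  have hsz : s - y * z ∉ Z := by
    intro hh
    exact hsZ ((Submodule.sub_mem_iff_left Z (Z.mul_mem_left y z.2)).1 hh)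
  apply cancel hZcar hsz
  linear_combination s * hz' + (z : A) * hy

lemma two_one (hZcar : ∀ r : A, r ∈ Z ↔ r ∉ nonZeroDivisors A)
    (hp : Z.IsPrime) (h : IsIFRing (Localization.AtPrime Z)) :
    IsSemicoherentRing A := by
  intro E F _ _ _ _ hE hF
  let H := E →ₗ[A] F
  let L := LocalizedModule Z.primeCompl H
  obtain ⟨G, hG, k, hk⟩ := exists_inj (A := Localization.AtPrime Z) L
  letI : Module A G := Module.compHom G (algebraMap A (Localization.AtPrime Z))
  haveI : IsScalarTower A (Localization.AtPrime Z) G :=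
    IsScalarTower.of_algebraMap_smul (fun _ _ => rfl)
  haveI := h G hG
  haveI : Module.Flat A (Localization.AtPrime Z) := IsLocalization.flat _ Z.primeCompl
  refine ⟨ModuleCat.of A G, Module.Flat.trans A (Localization.AtPrime Z) G,
    (k.restrictScalars A) ∘ₗ LocalizedModule.mkLinearMap Z.primeCompl H, ?_⟩
  refine Function.Injective.comp (g := k) hk ?_
  rw [injective_iff_map_eq_zero]
  intro f hf
  obtain ⟨⟨s, hs⟩, hsf⟩ := (IsLocalizedModule.eq_zero_iff Z.primeCompl
    (LocalizedModule.mkLinearMap Z.primeCompl H)).1 hf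
  have hsf' : s • f = 0 := hsf
  ext e
  obtain ⟨e', rfl⟩ := divide hE s e (by
    intro c hc
    rw [cancel hZcar hs hc, zero_smul])
  have := LinearMap.congr_fun hsf' e'
  simpa using this

/-- Annihilators are principal up to localization. -/
lemma ann_principal (hZcar : ∀ r : A, r ∈ Z ↔ r ∉ nonZeroDivisors A)
    (hv : IsChainRing A) (hp : Z.IsPrime) {r z : A} (hz : z ∈ Z)
    (hrz : r * z = 0) (hn : ∀ b, r * b = 0 → ∀ w ∈ Z, z ≠ b * w) (a : A) :
    ∃ b, a * b = 0 ∧ ∀ c, b * c = 0 → ∃ s, s ∉ Z ∧ ∃ y, s * c = a * y := by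
  have hr0 : r ≠ 0 := by
    rintro rfl
    exact hn 1 (by simp) z hz (by simp)
  have hr : ∀ c, r * c = 0 → ∃ s, s ∉ Z ∧ ∃ y, s * c = z * y := by
    intro c hc
    rcases chain_elt hv c z with ⟨t, rfl⟩ | ⟨t, rfl⟩
    · exact ⟨1, hp.one_notMem, t, by ring⟩
    · exact ⟨t, fun ht => hn c hc t ht rfl, 1, by ring⟩
  have hz2 : ∀ c, z * c = 0 → ∃ s, s ∉ Z ∧ ∃ y, s * c = r * y := by
    intro c hc
    apply double_ann hZcar hv hp hr0
    intro x hx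
    obtain ⟨s, hs, y, hy⟩ := hr x hx
    apply cancel hZcar hs
    linear_combination c * hy + y * hc
  by_cases ha : a = 0
  · subst ha
    refine ⟨1, by simp, fun c hc => ⟨1, hp.one_notMem, 0, ?_⟩⟩
    simpa using hc
  rcases chain_elt hv z a with ⟨t, ht⟩ | ⟨t, ht⟩
  · refine ⟨t * r, by linear_combination hrz - r * ht, fun c hc => ?_⟩
    rcases chain_elt hv c a with ⟨x, hx⟩ | ⟨x, hx⟩
    · exact ⟨1, hp.one_notMem, x, by linear_combination hx⟩
    · refine ⟨x, fun hxZ => hn (c * t) (by linear_combination hc) x hxZ ?_, 1, ?_⟩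
      · linear_combination ht + t * hx
      · linear_combination -hx
  · obtain ⟨w, hw⟩ : ∃ w, r = t * w := by
      rcases chain_elt hv t r with ⟨x, hx⟩ | h
      · exact absurd (by linear_combination ht + z * hx + x * hrz) ha
      · exact h
    refine ⟨w, by linear_combination w * ht + hrz - z * hw, fun c hc => ?_⟩
    apply double_ann hZcar hv hp ha
    intro x hx
    obtain ⟨s, hs, y, hy⟩ := hz2 (x * t) (by linear_combination hx - x * ht)
    apply cancel hZcar hs
    rcases chain_elt hv (s * x - w * y) w with ⟨v, hv'⟩ | ⟨v, hv'⟩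
    · linear_combination c * hv' + (y + v) * hc
    · exfalso
      apply hr0
      linear_combination hw + t * hv' + v * hy + v * y * hw

lemma three_two (hZcar : ∀ r : A, r ∈ Z ↔ r ∉ nonZeroDivisors A)
    (hv : IsChainRing A) (hp : Z.IsPrime) (hn : ¬ Module.Flat A Z) :
    IsIFRing (Localization.AtPrime Z) := by
  obtain ⟨r, z, hrz, hbad⟩ : ∃ (r : A) (z : Z), r • z = 0 ∧
      ∀ (b : A) (w : Z), r * b = 0 → z ≠ b • w := by
    by_contra hcon
    push Not at hcon
    exact hn (flat_of_chain hv Z (fun a m h => hcon a m h))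
  have key := ann_principal hZcar hv hp (r := r) (z := z) z.2
    (by simpa using congrArg Subtype.val hrz)
    (fun b hb w hw h => hbad b ⟨w, hw⟩ hb (Subtype.ext h))
  have hvQ : IsChainRing (Localization.AtPrime Z) := by
    intro I J
    have := hv (IsLocalization.orderEmbedding Z.primeCompl (Localization.AtPrime Z) I)
      (IsLocalization.orderEmbedding Z.primeCompl (Localization.AtPrime Z) J)
    simpa only [OrderEmbedding.le_iff_le] using this
  intro M _ _ hM
  apply flat_of_chain hvQ
  intro q m hqm
  obtain ⟨a, s, rfl⟩ := IsLocalization.exists_mk'_eq Z.primeCompl q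
  have hu : ∀ s : Z.primeCompl, IsUnit (algebraMap A (Localization.AtPrime Z) s) :=
    fun s => IsLocalization.map_units _ s
  have hspec := IsLocalization.mk'_spec (Localization.AtPrime Z) a s
  have ham : algebraMap A (Localization.AtPrime Z) a • m = 0 := by
    rw [← hspec, mul_comm, mul_smul, hqm, smul_zero]
  obtain ⟨b, hab, hb⟩ := key a
  obtain ⟨m', hm'⟩ := divide hM (algebraMap A (Localization.AtPrime Z) b) m (by
    intro p hp'
    obtain ⟨c, t, rfl⟩ := IsLocalization.exists_mk'_eq Z.primeCompl p
    have hspec' := IsLocalization.mk'_spec (Localization.AtPrime Z) c t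
    have h1 : algebraMap A (Localization.AtPrime Z) (b * c) = 0 := by
      rw [map_mul, ← hspec', ← mul_assoc, hp', zero_mul]
    obtain ⟨⟨v, hvZ⟩, hv'⟩ := (IsLocalization.map_eq_zero_iff Z.primeCompl _ _).1 h1
    have hbc : b * c = 0 := cancel hZcar hvZ hv'
    obtain ⟨w, hw, y, hy⟩ := hb c hbc
    have h2 := congrArg (algebraMap A (Localization.AtPrime Z)) hy
    rw [map_mul, map_mul, ← hspec'] at h2
    have h3 : (algebraMap A (Localization.AtPrime Z) w *
        algebraMap A (Localization.AtPrime Z) t) •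
        (IsLocalization.mk' (Localization.AtPrime Z) c t • m) = 0 := by
      rw [smul_smul, mul_assoc, mul_comm (algebraMap A _ (t : A)), h2, mul_comm, mul_smul, ham,
        smul_zero]
    exact (((hu ⟨w, hw⟩).mul (hu t)).smul_eq_zero).1 h3)
  refine ⟨_, m', ?_, hm'⟩
  apply (hu s).mul_left_cancel
  rw [← mul_assoc, mul_comm (algebraMap A _ (s : A)), hspec, ← map_mul, hab, map_zero, mul_zero]

end SemicoherentAux

/-- Let `R` be a valuation ring and `Z` its set of zerodivisors, which is a
prime ideal of `R`; assume `Z ≠ 0`.  TFAE: (1) `R` is semicoherent; (2) `R_Z` is an IF-ring;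
(3) `Z` is not a flat `R`-module. -/
theorem valuationRing_tfae_semicoherent (R : Type u) [CommRing R] (hv : IsChainRing R)
    (Z : Ideal R) (hZcar : ∀ r : R, r ∈ Z ↔ r ∉ nonZeroDivisors R)
    (hZprime : Z.IsPrime) (hZ0 : Z ≠ ⊥) :
    haveI := hZprime
    List.TFAE [IsSemicoherentRing R,
      IsIFRing (Localization.AtPrime Z),
      ¬ Module.Flat R Z] := by
  tfae_have 1 → 3 := SemicoherentAux.one_three hZcar hv hZprime hZ0
  tfae_have 3 → 2 := SemicoherentAux.three_two hZcar hv hZprime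
  tfae_have 2 → 1 := SemicoherentAux.two_one hZcar hZprime
  tfae_finish
end

section
/- Let R be a valuation ring with maximal ideal P, and let Z denote its set of zerodivisors, which is a prime ideal. Then the following conditions are equivalent: (1) R is either coherent or not semicoherent; (2) for each multiplicative subset S of R and each injective R-module E, the localization S^{-1}E is an injective R-module; (3) for each multiplicative subset S of R and each FP-injective R-module E, S^{-1}E is FP-injective; (4) the localization at Z of the injective hull E_R(R/P) of R/P is FP-injective. -/
universe u

open CategoryTheory in
lemma aux_ext_iff_res {R : Type u} [CommRing R] (X Y : ModuleCat.{u} R)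
    (P : ProjectiveResolution X) :
    Subsingleton (((Ext R (ModuleCat.{u} R) 1).obj (Opposite.op X)).obj Y) ↔
      ∀ g : P.complex.X 1 ⟶ Y, P.complex.d 2 1 ≫ g = 0 →
        ∃ h : P.complex.X 0 ⟶ Y, P.complex.d 1 0 ≫ h = g := by
  rw [← ModuleCat.isZero_iff_subsingleton, (P.isoExt 1 Y).isZero_iff,
    ← HomologicalComplex.exactAt_iff_isZero_homology,
    HomologicalComplex.exactAt_iff' _ 0 1 2 (by simp) (by simp),
    ShortComplex.moduleCat_exact_iff]
  constructor
  · intro H g hg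
    obtain ⟨h, hh⟩ := H g hg
    exact ⟨h, hh⟩
  · intro H g hg
    obtain ⟨h, hh⟩ := H g hg
    exact ⟨h, hh⟩

/-- Every map from the kernel of `p` to `E` extends. -/
def AuxExt {R : Type u} [CommRing R] {M F : Type u} (E : Type u) [AddCommGroup M] [Module R M]
    [AddCommGroup F] [Module R F] [AddCommGroup E] [Module R E] (p : M →ₗ[R] F) : Prop :=
  ∀ g : LinearMap.ker p →ₗ[R] E, ∃ h : M →ₗ[R] E, ∀ k : LinearMap.ker p, h k = g k

lemma aux_transfer {R : Type u} [CommRing R] {M N F E : Type u} [AddCommGroup M] [Module R M]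
    [AddCommGroup N] [Module R N]
    [AddCommGroup F] [Module R F] [AddCommGroup E] [Module R E] (p : M →ₗ[R] F)
    (q : N →ₗ[R] F) (hp : Function.Surjective p) (hq : Function.Surjective q)
    [Module.Projective R M] [Module.Projective R N] (H : AuxExt E p) : AuxExt E q := by
  intro g
  obtain ⟨α, hα⟩ := Module.projective_lifting_property q p hq
  obtain ⟨β, hβ⟩ := Module.projective_lifting_property p q hp
  have hα' : ∀ x, q (α x) = p x := fun x => by rw [← hα]; rfl
  have hβ' : ∀ x, p (β x) = q x := fun x => by rw [← hβ]; rfl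
  obtain ⟨h, hh⟩ := H (g ∘ₗ (α.restrict (p := LinearMap.ker p) (q := LinearMap.ker q)
    (fun x hx => by simpa [hα'] using hx)))
  let γ : N →ₗ[R] LinearMap.ker q := (LinearMap.id - α ∘ₗ β).codRestrict _
    (fun x => by simp [hα', hβ'])
  refine ⟨h ∘ₗ β + g ∘ₗ γ, fun k => ?_⟩
  have h1 := hh ⟨β k, by simp [hβ']⟩
  simp only [LinearMap.add_apply, LinearMap.comp_apply] at h1 ⊢
  rw [h1, ← map_add]
  congr 1
  ext
  simp [γ]

open CategoryTheory in
lemma aux_ext_iff {R : Type u} [CommRing R] {M F E : Type u} [AddCommGroup M] [Module R M]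
    [AddCommGroup F] [Module R F] [AddCommGroup E] [Module R E] (p : M →ₗ[R] F)
    (hp : Function.Surjective p) [Module.Projective R M] :
    Subsingleton (((Ext R (ModuleCat.{u} R) 1).obj
      (Opposite.op (ModuleCat.of R F))).obj (ModuleCat.of R E)) ↔ AuxExt E p := by
  let P := projectiveResolution (ModuleCat.of R F)
  let q : P.complex.X 0 →ₗ[R] F := (P.π.f 0).hom
  have hq : Function.Surjective q := (ModuleCat.epi_iff_surjective _).1 (inferInstance : Epi (P.π.f 0))
  have : Module.Projective R (P.complex.X 0) :=
    (IsProjective.iff_projective _).2 (P.projective 0)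
  have e0 := (ShortComplex.moduleCat_exact_iff _).1 P.exact₀
  have e1 := (ShortComplex.moduleCat_exact_iff _).1 (P.exact_succ 0)
  have hd : ∀ x, q ((P.complex.d 1 0).hom x) = 0 := fun x => by
    have := P.complex_d_comp_π_f_zero
    exact congrArg (fun f => f.hom x) this
  rw [aux_ext_iff_res _ _ P]
  have key : AuxExt E p ↔ AuxExt E q := ⟨aux_transfer p q hp hq, aux_transfer q p hq hp⟩
  rw [key]
  let d : P.complex.X 1 →ₗ[R] LinearMap.ker q := (P.complex.d 1 0).hom.codRestrict _ hd
  have hdsurj : Function.Surjective d := by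
    rintro ⟨x, hx⟩
    obtain ⟨y, hy⟩ := e0 x hx
    exact ⟨y, Subtype.ext hy⟩
  constructor
  · intro H g
    obtain ⟨h, hh⟩ := H (ModuleCat.ofHom (g ∘ₗ d)) (by
      ext x
      have : d ((P.complex.d 2 1).hom x) = 0 := by
        ext
        have := P.complex.d_comp_d 2 1 0
        exact congrArg (fun f => f.hom x) this
      simp only [ModuleCat.hom_comp, ModuleCat.hom_ofHom, LinearMap.comp_apply]
      rw [this]
      simp)
    refine ⟨h.hom, fun k => ?_⟩
    obtain ⟨y, rfl⟩ := hdsurj k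
    exact congrArg (fun f => f.hom y) hh
  · intro H g hg
    have hk : LinearMap.ker d ≤ LinearMap.ker g.hom := by
      intro x hx
      obtain ⟨y, hy⟩ := e1 x (congrArg Subtype.val hx)
      rw [LinearMap.mem_ker, ← hy]
      exact congrArg (fun f => f.hom y) hg
    let φ := (LinearMap.ker d).liftQ g.hom hk ∘ₗ (d.quotKerEquivOfSurjective hdsurj).symm.toLinearMap
    have hφ : ∀ x, φ (d x) = g.hom x := fun x => by
      have : (d.quotKerEquivOfSurjective hdsurj).symm (d x) = Submodule.Quotient.mk x := by
        rw [LinearEquiv.symm_apply_eq]; rfl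
      simp only [φ, LinearMap.comp_apply, LinearEquiv.coe_coe, this]
      rfl
    obtain ⟨h, hh⟩ := H φ
    refine ⟨ModuleCat.ofHom h, ?_⟩
    ext x
    have := hh (d x)
    rw [hφ] at this
    exact this

/-- Divisibility criterion (P-injective). -/
def AuxPInj (R : Type u) [CommRing R] (E : Type u) [AddCommGroup E] [Module R E] : Prop :=
  ∀ (r : R) (e : E), (∀ t : R, t * r = 0 → t • e = 0) → ∃ e' : E, e = r • e'

lemma aux_factor {R A B C : Type*} [CommRing R] [AddCommGroup A] [Module R A]
    [AddCommGroup B] [Module R B] [AddCommGroup C] [Module R C]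
    (d : A →ₗ[R] B) (hd : Function.Surjective d) (g : A →ₗ[R] C)
    (hk : ∀ x, d x = 0 → g x = 0) : ∃ φ : B →ₗ[R] C, ∀ x, φ (d x) = g x := by
  let φ := (LinearMap.ker d).liftQ g hk ∘ₗ (d.quotKerEquivOfSurjective hd).symm.toLinearMap
  refine ⟨φ, fun x => ?_⟩
  have : (d.quotKerEquivOfSurjective hd).symm (d x) = Submodule.Quotient.mk x := by
    rw [LinearEquiv.symm_apply_eq]; rfl
  simp only [φ, LinearMap.comp_apply, LinearEquiv.coe_coe, this]
  rfl

lemma aux_span_map {R E : Type*} [CommRing R] [AddCommGroup E] [Module R E] (r : R) (e : E)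
    (h : ∀ t : R, t * r = 0 → t • e = 0) :
    ∃ g : Ideal.span {r} →ₗ[R] E, ∀ t (ht : t * r ∈ Ideal.span {r}), g ⟨t * r, ht⟩ = t • e := by
  let d : R →ₗ[R] Ideal.span {r} := (LinearMap.toSpanSingleton R R r).codRestrict _
    (fun x => by simpa using Ideal.mul_mem_left _ x (Ideal.mem_span_singleton_self r))
  have hd : Function.Surjective d := by
    rintro ⟨x, hx⟩
    obtain ⟨t, rfl⟩ := Ideal.mem_span_singleton'.1 hx
    exact ⟨t, Subtype.ext (by simp [d])⟩
  obtain ⟨φ, hφ⟩ := aux_factor d hd (LinearMap.toSpanSingleton R E e) (fun x hx => by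
    have := congrArg Subtype.val hx
    simpa using h x (by simpa [d] using this))
  refine ⟨φ, fun t ht => ?_⟩
  exact (hφ t).trans (LinearMap.toSpanSingleton_apply R E e t)

lemma aux_pinj_of_fp {R : Type u} [CommRing R] {E : Type u} [AddCommGroup E] [Module R E]
    (H : IsFPInjective R E) : AuxPInj R E := by
  intro r e h
  let p : R →ₗ[R] (R ⧸ Ideal.span {r}) := (Ideal.span {r}).mkQ
  have hp : Function.Surjective p := Submodule.mkQ_surjective _
  have hker : LinearMap.ker p = Ideal.span {r} := Submodule.ker_mkQ _
  have hfp : Module.FinitePresentation R (R ⧸ Ideal.span {r}) := by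
    refine Module.finitePresentation_of_surjective p hp ?_
    rw [hker]
    exact ⟨{r}, by simp⟩
  have H1 := (aux_ext_iff p hp).1 (H _ hfp)
  obtain ⟨g, hg⟩ := aux_span_map r e h
  obtain ⟨h', hh'⟩ := H1 (g ∘ₗ (LinearEquiv.ofEq _ _ hker).toLinearMap)
  have hr : r ∈ LinearMap.ker p := by rw [hker]; exact Ideal.mem_span_singleton_self r
  have h1 := hh' ⟨r, hr⟩
  refine ⟨h' 1, ?_⟩
  rw [← map_smul]
  have h2 := hg 1 (by rw [one_mul, ← hker]; exact hr)
  rw [one_smul] at h2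
  rw [← h2]
  simp only [smul_eq_mul, mul_one]
  rw [show h' r = _ from h1]
  simp only [LinearMap.comp_apply]
  congr 1
  ext
  simp

lemma aux_pivot {R : Type*} [CommRing R] (hd : ∀ x y : R, x ∣ y ∨ y ∣ x) {ι : Type*}
    (s : Finset ι) (hs : s.Nonempty) (f : ι → R) : ∃ i ∈ s, ∀ j ∈ s, f i ∣ f j := by
  classical
  induction hs using Finset.Nonempty.cons_induction with
  | singleton a => exact ⟨a, by simp, by simp⟩
  | cons a s ha hs ih =>
    obtain ⟨i, hi, h⟩ := ih
    rcases hd (f a) (f i) with h1 | h1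
    · exact ⟨a, by simp, fun j hj => by
        rcases Finset.mem_cons.1 hj with rfl | hj
        · exact dvd_rfl
        · exact h1.trans (h j hj)⟩
    · exact ⟨i, by simp [hi], fun j hj => by
        rcases Finset.mem_cons.1 hj with rfl | hj
        · exact h1
        · exact h j hj⟩

lemma aux_solve {R : Type u} [CommRing R] (hd : ∀ x y : R, x ∣ y ∨ y ∣ x)
    {E : Type u} [AddCommGroup E] [Module R E] (H : AuxPInj R E) {ι J : Type*} [DecidableEq ι]
    [Fintype J] [DecidableEq J] (m : ℕ) : ∀ (s : Finset ι) (_ : s.card = m) (v : ι → J → R) (e : ι → E)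
    (_ : ∀ c : ι → R, (∀ j, ∑ i ∈ s, c i * v i j = 0) → ∑ i ∈ s, c i • e i = 0),
    ∃ x : J → E, ∀ i ∈ s, ∑ j, v i j • x j = e i := by
  induction m with
  | zero =>
    intro s hs v e _
    rw [Finset.card_eq_zero] at hs
    subst hs
    exact ⟨0, by simp⟩
  | succ m ih =>
    intro s hs v e hc
    rcases isEmpty_or_nonempty J with hJ | hJ
    · refine ⟨0, fun i hi => ?_⟩
      have := hc (Pi.single i 1) (fun j => hJ.elim j)
      simp only [Pi.single_apply, ite_smul, one_smul, zero_smul, Finset.sum_ite_eq', hi,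
        if_true] at this
      simp [this]
    · have hne : s.Nonempty := Finset.card_pos.1 (by omega)
      obtain ⟨⟨i0, j0⟩, hi0, hp⟩ := aux_pivot hd (s ×ˢ (Finset.univ : Finset J))
        (hne.product Finset.univ_nonempty) (fun p => v p.1 p.2)
      simp only [Finset.mem_product, Finset.mem_univ, and_true] at hi0 hp
      have hp' : ∀ i ∈ s, ∀ j, ∃ q, v i j = v i0 j0 * q := fun i hi j => hp (i, j) hi
      have hq : ∀ i, ∃ q, i ∈ s → v i j0 = v i0 j0 * q := fun i => by
        by_cases hi : i ∈ s
        · obtain ⟨q, hq⟩ := hp' i hi j0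
          exact ⟨q, fun _ => hq⟩
        · exact ⟨0, fun h => absurd h hi⟩
      choose q hq using hq
      choose b hb using hp' i0 hi0
      obtain ⟨x, hx⟩ := ih (s.erase i0) (by rw [Finset.card_erase_of_mem hi0]; omega)
        (fun i j => v i j - q i * v i0 j) (fun i => e i - q i • e i0) (by
          intro c h
          have := hc (fun i => if i = i0 then - ∑ k ∈ s.erase i0, c k * q k else c i) (by
            intro j
            rw [← Finset.add_sum_erase _ _ hi0]
            have h' := h j
            simp only [mul_sub, Finset.sum_sub_distrib] at h'
            have hsum : ∑ i ∈ s.erase i0, (if i = i0 then - ∑ k ∈ s.erase i0, c k * q k else c i)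
                * v i j = ∑ i ∈ s.erase i0, c i * v i j := Finset.sum_congr rfl (fun i hi => by
              rw [if_neg (Finset.ne_of_mem_erase hi)])
            rw [hsum, if_pos rfl, sub_eq_zero.1 h', neg_mul, Finset.sum_mul]
            simp [mul_assoc])
          have hsum : ∑ i ∈ s.erase i0, (if i = i0 then - ∑ k ∈ s.erase i0, c k * q k else c i)
              • e i = ∑ i ∈ s.erase i0, c i • e i := Finset.sum_congr rfl (fun i hi => by
            rw [if_neg (Finset.ne_of_mem_erase hi)])
          rw [← Finset.add_sum_erase _ _ hi0, hsum, if_pos rfl] at this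
          simp only [smul_sub, Finset.sum_sub_distrib]
          rw [neg_smul, Finset.sum_smul, neg_add_eq_sub] at this
          simpa [mul_smul] using this)
      obtain ⟨y, hy⟩ := H (v i0 j0) (e i0) (by
        intro t ht
        have := hc (Pi.single i0 t) (fun j => by
          simp only [Pi.single_apply, ite_mul, zero_mul, Finset.sum_ite_eq', hi0, if_true]
          rw [hb j, ← mul_assoc, ht, zero_mul])
        simpa only [Pi.single_apply, ite_smul, zero_smul, Finset.sum_ite_eq', hi0, if_true]
          using this)
      let x' : J → E := Function.update x j0 (y - ∑ j ∈ Finset.univ.erase j0, b j • x j)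
      have hrow0 : ∑ j, v i0 j • x' j = e i0 := by
        rw [← Finset.add_sum_erase _ _ (Finset.mem_univ j0)]
        rw [Finset.sum_congr rfl (g := fun j => v i0 j0 • b j • x j) (fun j hj => by
          simp only [x']
          rw [Function.update_of_ne (Finset.ne_of_mem_erase hj), hb j, mul_smul])]
        rw [← Finset.smul_sum]
        simp only [x', Function.update_self]
        rw [← smul_add, sub_add_cancel, ← hy]
      refine ⟨x', fun i hi => ?_⟩
      by_cases hii : i = i0
      · subst hii; exact hrow0
      · have h1 := hx i (Finset.mem_erase.2 ⟨hii, hi⟩)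
        have h2 : ∑ j, (v i j - q i * v i0 j) • x' j = ∑ j, (v i j - q i * v i0 j) • x j := by
          refine Finset.sum_congr rfl fun j _ => ?_
          by_cases hj : j = j0
          · subst hj
            rw [hq i hi]
            rw [mul_comm (q i), sub_self, zero_smul, zero_smul]
          · simp only [x']; rw [Function.update_of_ne hj]
        rw [h1] at h2
        simp only [sub_smul, Finset.sum_sub_distrib, mul_smul] at h2
        rw [← Finset.smul_sum, hrow0] at h2
        exact sub_left_injective h2

lemma aux_fp_of_pinj {R : Type u} [CommRing R] (hd : ∀ x y : R, x ∣ y ∨ y ∣ x)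
    {E : Type u} [AddCommGroup E] [Module R E]
    (H : AuxPInj R E) : IsFPInjective R E := by
  classical
  intro F _ _ hF
  obtain ⟨n, p, hp⟩ := Module.Finite.exists_fin' R F
  rw [aux_ext_iff p hp]
  intro g
  obtain ⟨s, hs⟩ := Module.FinitePresentation.fg_ker p hp
  have hsK : ∀ i ∈ s, i ∈ LinearMap.ker p := fun i hi => by
    rw [← hs]; exact Submodule.subset_span hi
  let e : (Fin n → R) → E := fun i => if h : i ∈ LinearMap.ker p then g ⟨i, h⟩ else 0
  obtain ⟨x, hx⟩ := aux_solve hd H s.card s rfl (fun i => i) e (by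
    intro c hc
    have h1 : ∑ i ∈ s.attach, c i • (⟨i.1, hsK i.1 i.2⟩ : LinearMap.ker p) = 0 := by
      ext j
      have := hc j
      rw [← Finset.sum_attach] at this
      simpa using this
    have h2 := congrArg g h1
    rw [map_sum, map_zero] at h2
    rw [← Finset.sum_attach, ← h2]
    refine Finset.sum_congr rfl fun i _ => ?_
    rw [map_smul]
    simp only [e]
    rw [dif_pos (hsK i.1 i.2)])
  let h : (Fin n → R) →ₗ[R] E := ∑ j, (LinearMap.proj j).smulRight (x j)
  have hh : ∀ y, h y = ∑ j, y j • x j := fun y => by simp [h]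
  refine ⟨h, ?_⟩
  rintro ⟨k, hk⟩
  have hk' : k ∈ Submodule.span R (s : Set (Fin n → R)) := by rw [hs]; exact hk
  induction hk' using Submodule.span_induction with
  | mem y hy =>
    have := hx y hy
    simp only [hh, this, e]
    rw [dif_pos hk]
  | zero => exact (map_zero h).trans (map_zero g).symm
  | add a b ha hb iha ihb =>
    have ha' : a ∈ LinearMap.ker p := by rw [← hs]; exact ha
    have hb' : b ∈ LinearMap.ker p := by rw [← hs]; exact hb
    have := congrArg₂ (· + ·) (iha ha') (ihb hb')
    exact (map_add h a b).trans (this.trans (map_add g ⟨a, ha'⟩ ⟨b, hb'⟩).symm)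
  | smul c a ha iha =>
    have ha' : a ∈ LinearMap.ker p := by rw [← hs]; exact ha
    have := congrArg (c • ·) (iha ha')
    exact (map_smul h c a).trans (this.trans (map_smul g c ⟨a, ha'⟩).symm)

lemma aux_pinj_of_inj {R : Type u} [CommRing R] {E : Type u} [AddCommGroup E] [Module R E]
    (H : Module.Injective R E) : AuxPInj R E := by
  intro r e h
  obtain ⟨g, hg⟩ := aux_span_map r e h
  obtain ⟨g', hg'⟩ := Module.Baer.of_injective H _ g
  have hr := Ideal.mem_span_singleton_self r
  refine ⟨g' 1, ?_⟩
  have h1 := hg 1 (by rw [one_mul]; exact hr)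
  rw [← map_smul, smul_eq_mul, mul_one, hg' r hr, ← one_smul R e, ← h1]
  simp

lemma aux_nzd {R : Type*} [CommRing R] (hd : ∀ x y : R, x ∣ y ∨ y ∣ x) (c z : R)
    (h0 : c * z ≠ 0) (h : ∀ t, t * (c * z) = 0 → t * c = 0) : z ∈ nonZeroDivisors R := by
  rw [mem_nonZeroDivisors_iff_right]
  intro w hw
  rcases hd c w with ⟨q, rfl⟩ | ⟨q, rfl⟩
  · rw [mul_comm]
    exact h q (by rw [← hw]; ring)
  · exact absurd (by rw [mul_right_comm, hw, zero_mul]) h0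

lemma aux_double {R : Type*} [CommRing R] (hd : ∀ x y : R, x ∣ y ∨ y ∣ x) (x y : R)
    (hx : x ≠ 0) (h : ∀ t, t * x = 0 → t * y = 0) :
    x ∣ y ∨ ∃ z ∈ nonZeroDivisors R, x = y * z := by
  rcases hd x y with h1 | ⟨z, rfl⟩
  · exact Or.inl h1
  · exact Or.inr ⟨z, aux_nzd hd y z hx h, rfl⟩

/-- Some nonzero element has nonzero annihilator which is principal after passing to the
total ring of quotients. -/
def AuxStar (R : Type u) [CommRing R] : Prop :=
  ∃ r a : R, r ≠ 0 ∧ a ≠ 0 ∧ a * r = 0 ∧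
    ∀ t, t * r = 0 → ∃ z ∈ nonZeroDivisors R, a ∣ z * t

lemma aux_loc_zero {R : Type*} [CommRing R] (S : Submonoid R) {E : Type*} [AddCommGroup E]
    [Module R E] (e : E) (s : S) : LocalizedModule.mk e s = 0 ↔ ∃ u ∈ S, u • e = 0 := by
  rw [← LocalizedModule.zero_mk s, LocalizedModule.mk_eq]
  constructor
  · rintro ⟨u, hu⟩
    refine ⟨u * s, (u * s).2, ?_⟩
    simpa [mul_smul, Submonoid.smul_def] using hu
  · rintro ⟨u, hu, h⟩
    refine ⟨⟨u, hu⟩, ?_⟩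
    rw [smul_comm]
    simp [Submonoid.smul_def, h]

lemma aux_pinj_loc {R : Type u} [CommRing R] (hd : ∀ x y : R, x ∣ y ∨ y ∣ x) (S : Submonoid R)
    {E : Type u} [AddCommGroup E] [Module R E] (H : AuxPInj R E)
    (hstar : AuxStar R → ∀ z ∈ nonZeroDivisors R, IsUnit z) :
    AuxPInj R (LocalizedModule S E) := by
  intro r x hx
  induction x using LocalizedModule.induction_on with
  | h e s0 =>
  have hA : ∀ t, t * r = 0 → ∃ u ∈ S, u • t • e = 0 := by
    intro t ht
    have := hx t ht
    rw [LocalizedModule.smul'_mk, aux_loc_zero] at this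
    exact this
  suffices h : ∃ s ∈ S, ∀ t, t * r = 0 → (t * s) • e = 0 by
    obtain ⟨s, hs, h⟩ := h
    obtain ⟨e', he'⟩ := H r (s • e) (fun t ht => by rw [← mul_smul]; exact h t ht)
    refine ⟨LocalizedModule.mk e' (⟨s, hs⟩ * s0), ?_⟩
    rw [LocalizedModule.smul'_mk, ← he']
    exact (LocalizedModule.mk_cancel_common_left ⟨s, hs⟩ s0 e).symm
  by_cases hr0 : r = 0
  · subst hr0
    obtain ⟨u, hu, h⟩ := hA 1 (by simp)
    refine ⟨u, hu, fun t _ => ?_⟩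
    rw [one_smul] at h
    rw [mul_smul, h, smul_zero]
  by_cases hS : ∃ s ∈ S, s ∉ nonZeroDivisors R
  · obtain ⟨s, hs, hsZ⟩ := hS
    rcases hd s r with ⟨c, rfl⟩ | ⟨c, rfl⟩
    · rw [mul_comm s c] at *
      have : ¬ ∀ t, t * (c * s) = 0 → t * c = 0 := fun h => hsZ (aux_nzd hd c s hr0 h)
      push Not at this
      obtain ⟨a, ha, hac⟩ := this
      obtain ⟨s', hs', h⟩ := hA a ha
      refine ⟨s' * s, S.mul_mem hs' hs, fun t ht => ?_⟩
      rcases hd a (t * s) with ⟨q, hq⟩ | ⟨q, hq⟩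
      · rw [show t * (s' * s) = q * (s' * a) by linear_combination s' * hq, mul_smul, mul_smul, h,
          smul_zero]
      · exact absurd (by rw [hq]; linear_combination q * ht) hac
    · exact ⟨r * c, hs, fun t ht => by
        rw [← mul_assoc, ht, zero_mul, zero_smul]⟩
  push Not at hS
  by_cases hz : ∃ z ∈ nonZeroDivisors R, ∀ s ∈ S, ¬ z ∣ s
  · obtain ⟨z, hz, hzS⟩ := hz
    refine ⟨1, S.one_mem, fun t ht => ?_⟩
    rw [mul_one]
    rcases hd z t with ⟨t', rfl⟩ | ⟨q, hq⟩
    · have ht' : t' * r = 0 := by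
        refine (mem_nonZeroDivisors_iff_right.1 hz) _ ?_
        rw [← ht]; ring
      obtain ⟨u, hu, h⟩ := hA t' ht'
      obtain ⟨w, rfl⟩ := (hd z u).resolve_left (hzS u hu)
      rw [show u * w * t' = w * (u * t') by ring, mul_smul, mul_smul, h, smul_zero]
    · have : z * r = 0 := by rw [hq, mul_right_comm, ht, zero_mul]
      exact absurd ((mem_nonZeroDivisors_iff_right.1 hz) r (by rw [mul_comm]; exact this)) hr0
  push Not at hz
  refine ⟨1, S.one_mem, fun a ha => ?_⟩
  rw [mul_one]
  by_contra hae
  have hstar' : AuxStar R := by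
    refine ⟨r, a, hr0, ?_, ha, ?_⟩
    · rintro rfl; simp at hae
    · intro t ht
      obtain ⟨u, hu, h⟩ := hA t ht
      refine ⟨u, hS u hu, ?_⟩
      rcases hd a (u * t) with h1 | ⟨q, hq⟩
      · exact h1
      · exact absurd (by rw [hq, mul_comm, mul_smul, mul_smul, h, smul_zero]) hae
  obtain ⟨u, hu, h⟩ := hA a ha
  have huu := hstar hstar' u (hS u hu)
  exact hae (huu.smul_eq_zero.1 h)

lemma aux_inj_loc {R : Type u} [CommRing R] (hd : ∀ x y : R, x ∣ y ∨ y ∣ x) (S : Submonoid R)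
    {E : Type u} [AddCommGroup E] [Module R E] (HE : Module.Injective R E)
    (H : AuxPInj R (LocalizedModule S E)) : Module.Injective R (LocalizedModule S E) := by
  have HP := aux_pinj_of_inj HE
  have hdiv : ∀ s ∈ S, ∀ x : LocalizedModule S E, s • x = 0 → x = 0 := by
    intro s hs x hx
    induction x using LocalizedModule.induction_on with
    | h e s0 =>
    rw [LocalizedModule.smul'_mk, aux_loc_zero] at hx
    obtain ⟨u, hu, h⟩ := hx
    rw [aux_loc_zero]
    exact ⟨u * s, S.mul_mem hu hs, by rw [mul_smul]; exact h⟩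
  let ι := LocalizedModule.mkLinearMap S E
  have hι : ∀ e, ι e = 0 ↔ ∃ u ∈ S, u • e = 0 := fun e => aux_loc_zero S e 1
  -- every map is given on each principal piece
  have hloc : ∀ (I : Ideal R) (φ : I →ₗ[R] LocalizedModule S E) (k : I),
      ∃ x, φ k = (k : R) • x := by
    intro I φ k
    refine H k (φ k) (fun t ht => ?_)
    rw [← map_smul, show t • k = 0 from Subtype.ext ht, map_zero]
  -- the lifted situation
  have hlift : ∀ (I : Ideal R) (φ : I →ₗ[R] LocalizedModule S E),
      (∀ k : I, ∃ i : I, ∃ c : R, (k : R) = i * c ∧ ∀ s ∈ S, s ∣ c) →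
      (∀ k : I, ∃ e : E, φ k = (k : R) • ι e) → ∃ e : E, ∀ k : I, φ k = (k : R) • ι e := by
    intro I φ h1 h2
    choose κ c hκ hc using h1
    choose e he using h2
    have wd : ∀ (i k k1 : I) (c c1 : R), (i : R) = k * c → (i : R) = k1 * c1 →
        (∀ s ∈ S, s ∣ c) → (∀ s ∈ S, s ∣ c1) → (i : R) • e k = (i : R) • e k1 := by
      have main : ∀ (i k k1 : I) (c m : R), (i : R) = k * c → (k : R) = k1 * m →
        (∀ s ∈ S, s ∣ c) → (i : R) • e k = (i : R) • e k1 := by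
        intro i k k1 c m hi hk hc
        have h0 : ι ((k : R) • (e k - e k1)) = 0 := by
          rw [map_smul, map_sub, smul_sub, ← he k, sub_eq_zero, show k = m • k1 from
            Subtype.ext (by rw [hk]; simp [mul_comm]), map_smul, he k1, ← mul_smul]
          simp
        obtain ⟨u, hu, h⟩ := (hι _).1 h0
        obtain ⟨d, hd'⟩ := hc u hu
        rw [← sub_eq_zero, ← smul_sub, hi, hd', show (k : R) * (u * d) = d * (u * k) by ring,
          mul_smul, mul_smul, h, smul_zero]
      intro i k k1 c c1 hi hi1 hc hc1
      rcases hd (k1 : R) k with ⟨m, hm⟩ | ⟨m, hm⟩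
      · exact main i k k1 c m hi hm hc
      · exact (main i k1 k c1 m hi1 hm hc1).symm
    have hwd : ∀ (i k : I) (d : R), (i : R) = k * d → (∀ s ∈ S, s ∣ d) →
        (i : R) • e (κ i) = (i : R) • e k := fun i k d h h' => wd i _ _ _ _ (hκ i) h (hc i) h'
    let ψ : I →ₗ[R] E :=
      { toFun := fun i => (i : R) • e (κ i)
        map_add' := by
          intro i j
          rcases hd (i : R) j with ⟨m, hm⟩ | ⟨m, hm⟩
          · rw [hwd j (κ i) (c i * m) (by rw [hm, hκ i]; ring) (fun s hs => (hc i s hs).mul_right m),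
              hwd (i + j) (κ i) (c i + c i * m)
                (by rw [Submodule.coe_add, hm]; nth_rw 1 2 [hκ i]; ring)
                (fun s hs => (hc i s hs).add ((hc i s hs).mul_right m))]
            simp [add_smul]
          · rw [hwd i (κ j) (c j * m) (by rw [hm, hκ j]; ring) (fun s hs => (hc j s hs).mul_right m),
              hwd (i + j) (κ j) (c j * m + c j)
                (by rw [Submodule.coe_add, hm]; nth_rw 1 2 [hκ j]; ring)
                (fun s hs => ((hc j s hs).mul_right m).add (hc j s hs))]
            simp [add_smul]
        map_smul' := by
          intro m i
          rw [hwd (m • i) (κ i) (m * c i) (by simp only [Submodule.coe_smul, smul_eq_mul]; nth_rw 1 [hκ i]; ring)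
            (fun s hs => (hc i s hs).mul_left m)]
          simp [mul_smul] }
    obtain ⟨ψ', hψ'⟩ := Module.Baer.of_injective HE I ψ
    refine ⟨ψ' 1, fun k => ?_⟩
    have h3 : (k : R) • ψ' 1 = (k : R) • e (κ k) := by
      rw [← map_smul, smul_eq_mul, mul_one]
      exact hψ' k k.2
    rw [← map_smul, h3, map_smul]
    have hk : k = c k • κ k := Subtype.ext (by
      rw [Submodule.coe_smul, smul_eq_mul, mul_comm]; exact hκ k)
    have hk2 : φ k = c k • φ (κ k) := by rw [← map_smul, ← hk]
    rw [hk2, he (κ k), ← mul_smul]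
    rw [mul_comm (c k), ← hκ k]
  apply Module.Baer.injective
  suffices h : ∀ (I : Ideal R) (φ : I →ₗ[R] LocalizedModule S E),
      ∃ x, ∀ k : I, φ k = (k : R) • x by
    intro I φ
    obtain ⟨x, hx⟩ := h I φ
    exact ⟨LinearMap.toSpanSingleton R _ x, fun y hy => by
      rw [hx ⟨y, hy⟩, LinearMap.toSpanSingleton_apply]⟩
  intro I φ
  by_cases hI : ∃ k : I, ∀ i : I, ∃ s ∈ S, (k : R) ∣ s * i
  · obtain ⟨k, hk⟩ := hI
    obtain ⟨x, hx⟩ := hloc I φ k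
    refine ⟨x, fun i => ?_⟩
    obtain ⟨s, hs, m, hm⟩ := hk i
    rw [← sub_eq_zero]
    refine hdiv s hs _ ?_
    rw [smul_sub, ← mul_smul, hm, ← map_smul, show s • i = m • k from
      Subtype.ext (by simp [hm, mul_comm]), map_smul, hx, sub_eq_zero, ← mul_smul, mul_comm]
  push Not at hI
  have h1 : ∀ k : I, ∃ i : I, ∃ c : R, (k : R) = i * c ∧ ∀ s ∈ S, s ∣ c := by
    intro k
    obtain ⟨i, hi⟩ := hI k
    have h' := hi 1 S.one_mem
    rw [one_mul] at h'
    obtain ⟨c, hc⟩ := (hd (k : R) i).resolve_left h'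
    refine ⟨i, c, hc, fun s hs => (hd s c).resolve_right ?_⟩
    rintro ⟨q, rfl⟩
    exact hi _ hs ⟨q, by rw [hc]; ring⟩
  by_cases hK : ∀ k : I, ∃ s ∈ S, s * (k : R) = 0
  · refine ⟨0, fun k => ?_⟩
    obtain ⟨s, hs, h⟩ := hK k
    rw [smul_zero]
    refine hdiv s hs _ ?_
    rw [← map_smul, show s • k = 0 from Subtype.ext h, map_zero]
  push Not at hK
  obtain ⟨k0, hk0⟩ := hK
  obtain ⟨x0, hx0⟩ := hloc I φ k0
  have hsub : ∀ k : I, (φ - (LinearMap.toSpanSingleton R _ x0) ∘ₗ I.subtype) k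
      = φ k - (k : R) • x0 := fun k => by simp
  obtain ⟨e, he⟩ := hlift I (φ - (LinearMap.toSpanSingleton R _ x0) ∘ₗ I.subtype) h1 (by
    intro k
    rcases hd (k0 : R) k with ⟨m, hm⟩ | ⟨m, hm⟩
    · refine ⟨0, ?_⟩
      rw [hsub, map_zero, smul_zero, sub_eq_zero, hm, mul_comm, mul_smul, ← hx0, ← map_smul]
      congr 1
      exact Subtype.ext (by simp [hm, mul_comm])
    · obtain ⟨x, hx⟩ := hloc I φ k
      have hkx : (k0 : R) • (x - x0) = 0 := by
        rw [smul_sub, ← hx0, hm, mul_comm, mul_smul, ← hx, ← map_smul, sub_eq_zero]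
        congr 1
        exact Subtype.ext (by simp [hm, mul_comm])
      suffices h : ∃ e, x - x0 = ι e by
        obtain ⟨e, h⟩ := h
        exact ⟨e, by rw [hsub, hx, ← smul_sub, h]⟩
      generalize x - x0 = y at hkx
      induction y using LocalizedModule.induction_on with
      | h e s =>
      rw [LocalizedModule.smul'_mk, aux_loc_zero] at hkx
      obtain ⟨u, hu, h⟩ := hkx
      obtain ⟨e1, he1⟩ := HP s e (by
        intro t ht
        rcases hd (u * k0) t with ⟨q, rfl⟩ | ⟨q, hq⟩
        · rw [mul_comm, mul_smul, mul_smul, h, smul_zero]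
        · refine absurd ?_ (hk0 (s * u) (S.mul_mem s.2 hu))
          rw [mul_assoc, hq]
          linear_combination q * ht)
      refine ⟨e1, ?_⟩
      rw [he1]
      have := LocalizedModule.mk_cancel s e1
      exact this)
  refine ⟨x0 + ι e, fun k => ?_⟩
  rw [smul_add, ← he k, hsub]
  abel

lemma aux_principal_ann {Q : Type*} [CommRing Q] (hd : ∀ x y : Q, x ∣ y ∨ y ∣ x)
    (hu : ∀ z ∈ nonZeroDivisors Q, IsUnit z) (r a : Q) (hr : r ≠ 0) (ha : a ≠ 0)
    (hra : ∀ t, t * r = 0 ↔ a ∣ t) (x : Q) : ∃ b, ∀ t, t * x = 0 ↔ b ∣ t := by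
  have hdbl : ∀ x y : Q, x ≠ 0 → (∀ t, t * x = 0 → t * y = 0) → x ∣ y := by
    intro x y hx h
    rcases aux_double hd x y hx h with h | ⟨z, hz, rfl⟩
    · exact h
    · exact (hu z hz).mul_right_dvd.2 dvd_rfl
  have har : a * r = 0 := (hra a).2 dvd_rfl
  have hann_a : ∀ t, t * a = 0 ↔ r ∣ t := by
    intro t
    constructor
    · intro h
      refine hdbl r t hr (fun s hs => ?_)
      obtain ⟨q, rfl⟩ := (hra s).1 hs
      rw [mul_right_comm, mul_comm a, h, zero_mul]
    · rintro ⟨q, rfl⟩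
      linear_combination q * har
  -- divisors of an element with principal annihilator
  have step : ∀ r a x c : Q, r ≠ 0 → (∀ t, t * r = 0 ↔ a ∣ t) → r = x * c →
      ∀ t, t * x = 0 ↔ c * a ∣ t := by
    intro r a x c hr hra hrx t
    constructor
    · intro ht
      rcases hd c t with ⟨y, rfl⟩ | ⟨y, rfl⟩
      · exact mul_dvd_mul_left c ((hra y).1 (by rw [hrx]; linear_combination ht))
      · exact absurd (by rw [hrx]; linear_combination y * ht) hr
    · rintro ⟨q, rfl⟩
      have := (hra a).2 dvd_rfl
      rw [hrx] at this
      linear_combination q * this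
  by_cases hx : x = 0
  · exact ⟨1, fun t => by simp [hx]⟩
  rcases hd x r with ⟨c, hc⟩ | ⟨c, rfl⟩
  · exact ⟨c * a, step r a x c hr hra hc⟩
  · obtain ⟨q, hq⟩ : c ∣ a := (hd c a).resolve_right (by
      rintro ⟨q, rfl⟩
      exact hx (by linear_combination q * har))
    have hc := step a r c q ha hann_a hq
    have hb : ∀ y, y * (r * c) = 0 ↔ ∃ u v, y = q * u + (q * r) * v := by
      intro y
      constructor
      · intro hy
        obtain ⟨z, hz⟩ := (hra (y * c)).1 (by rw [← hy]; ring)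
        obtain ⟨v, hv⟩ := (hc (y - q * z)).1 (by rw [sub_mul, hz, hq]; ring)
        exact ⟨z, v, by rw [← hv]; ring⟩
      · rintro ⟨u, v, rfl⟩
        have : q * c * r = 0 := by rw [mul_comm q, ← hq]; exact har
        linear_combination (u + r * v) * this
    refine ⟨q, fun t => ?_⟩
    rw [hb]
    constructor
    · rintro ⟨u, v, rfl⟩
      exact ⟨u + r * v, by ring⟩
    · rintro ⟨u, rfl⟩
      exact ⟨u, 0, by ring⟩

lemma aux_fg_principal {R : Type*} [CommRing R] (hd : ∀ x y : R, x ∣ y ∨ y ∣ x) (I : Ideal R)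
    (hI : I.FG) : ∃ x, I = Ideal.span {x} := by
  obtain ⟨s, rfl⟩ := hI
  rcases s.eq_empty_or_nonempty with rfl | hs
  · exact ⟨0, by simp⟩
  · obtain ⟨i, hi, h⟩ := aux_pivot hd s hs id
    refine ⟨i, le_antisymm ?_ ?_⟩
    · rw [Submodule.span_le]
      intro j hj
      exact Ideal.mem_span_singleton.2 (h j hj)
    · rw [Ideal.span_singleton_le_iff_mem]
      exact Submodule.subset_span hi

lemma aux_coherent {R : Type u} [CommRing R] (hd : ∀ x y : R, x ∣ y ∨ y ∣ x)
    (h : ∀ x : R, ∃ b, ∀ t, t * x = 0 ↔ b ∣ t) : IsCoherentRing R := by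
  intro I hI
  obtain ⟨x, rfl⟩ := aux_fg_principal hd I hI
  obtain ⟨b, hb⟩ := h x
  let d : R →ₗ[R] Ideal.span {x} := (LinearMap.toSpanSingleton R R x).codRestrict _
    (fun y => by simpa using Ideal.mul_mem_left _ y (Ideal.mem_span_singleton_self x))
  have hds : Function.Surjective d := by
    rintro ⟨y, hy⟩
    obtain ⟨t, rfl⟩ := Ideal.mem_span_singleton'.1 hy
    exact ⟨t, Subtype.ext (by simp [d])⟩
  refine Module.finitePresentation_of_surjective d hds ⟨{b}, ?_⟩
  ext t
  rw [Finset.coe_singleton]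
  change t ∈ Ideal.span {b} ↔ _
  rw [Ideal.mem_span_singleton, ← hb, LinearMap.mem_ker, ← Subtype.coe_inj]
  rfl

lemma aux_units_of_coherent {R : Type u} [CommRing R] (hd : ∀ x y : R, x ∣ y ∨ y ∣ x)
    (P : Ideal R) (hP : ∀ x, x ∈ P ↔ ¬ IsUnit x)
    (hc : IsCoherentRing R) (hs : AuxStar R) : ∀ z ∈ nonZeroDivisors R, IsUnit z := by
  obtain ⟨r, a, hr, ha, har, -⟩ := hs
  intro z hz
  by_contra hzu
  have hfp := hc (Ideal.span {r}) ⟨{r}, by simp⟩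
  let d : R →ₗ[R] Ideal.span {r} := (LinearMap.toSpanSingleton R R r).codRestrict _
    (fun y => by simpa using Ideal.mul_mem_left _ y (Ideal.mem_span_singleton_self r))
  have hds : Function.Surjective d := by
    rintro ⟨y, hy⟩
    obtain ⟨t, rfl⟩ := Ideal.mem_span_singleton'.1 hy
    exact ⟨t, Subtype.ext (by simp [d])⟩
  have hmem : ∀ t, t ∈ LinearMap.ker d ↔ t * r = 0 := fun t => by
    rw [LinearMap.mem_ker, ← Subtype.coe_inj]; rfl
  obtain ⟨b, hb⟩ := aux_fg_principal hd _ (Module.FinitePresentation.fg_ker d hds)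
  have hb' : ∀ t, t * r = 0 ↔ b ∣ t := fun t => by
    rw [← hmem, ← Ideal.mem_span_singleton, ← hb]
  have hbr := (hb' b).2 dvd_rfl
  have hb0 : b ≠ 0 := by
    rintro rfl
    exact ha (zero_dvd_iff.1 ((hb' a).1 har))
  rcases hd z b with ⟨c, hc⟩ | ⟨c, hc⟩
  · have : c * r = 0 := (mem_nonZeroDivisors_iff_right.1 hz) _ (by rw [← hbr, hc]; ring)
    obtain ⟨q, hq⟩ := (hb' c).1 this
    have h1 : b * (1 - z * q) = 0 := by
      linear_combination hc + z * hq
    have h2 : IsUnit (1 - z * q) := by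
      by_contra h
      have h3 : (1 : R) ∈ P := by
        have := P.add_mem ((hP _).2 h) (P.mul_mem_right q ((hP z).2 hzu))
        simpa using this
      exact (hP 1).1 h3 isUnit_one
    exact hb0 (h2.mul_left_eq_zero.1 h1)
  · exact hr ((mem_nonZeroDivisors_iff_right.1 hz) r (by rw [hc]; linear_combination c * hbr))

lemma aux_flat {Q : Type u} [CommRing Q] (hd : ∀ x y : Q, x ∣ y ∨ y ∣ x)
    (h : ∀ x : Q, ∃ b, (∀ t, t * x = 0 ↔ b ∣ t) ∧ ∀ t, t * b = 0 → x ∣ t) (M : Type u)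
    [AddCommGroup M] [Module Q M] (H : AuxPInj Q M) : Module.Flat Q M := by
  rw [Module.Flat.iff_lift_lsmul_comp_subtype_injective]
  intro I hI
  obtain ⟨x, rfl⟩ := aux_fg_principal hd I hI
  obtain ⟨b, hb, hb'⟩ := h x
  have hx := Ideal.mem_span_singleton_self x
  have hbx : b * x = 0 := (hb b).2 dvd_rfl
  have hrep : ∀ w : TensorProduct Q (Ideal.span {x}) M, ∃ m : M,
      w = (⟨x, hx⟩ : Ideal.span {x}) ⊗ₜ[Q] m := by
    intro w
    induction w using TensorProduct.induction_on with
    | zero => exact ⟨0, by simp⟩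
    | tmul i m =>
      obtain ⟨i, hi⟩ := i
      obtain ⟨t, rfl⟩ := Ideal.mem_span_singleton'.1 hi
      refine ⟨t • m, ?_⟩
      rw [← TensorProduct.smul_tmul]
      rfl
    | add u v hu hv =>
      obtain ⟨m, rfl⟩ := hu
      obtain ⟨n, rfl⟩ := hv
      exact ⟨m + n, by rw [TensorProduct.tmul_add]⟩
  rw [injective_iff_map_eq_zero]
  intro w hw
  obtain ⟨m, rfl⟩ := hrep w
  have hm : x • m = 0 := by simpa using hw
  obtain ⟨m', rfl⟩ := H b m (fun t ht => by
    obtain ⟨q, rfl⟩ := hb' t ht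
    rw [mul_comm, mul_smul, hm, smul_zero])
  rw [← TensorProduct.smul_tmul, show b • (⟨x, hx⟩ : Ideal.span {x}) = 0 from
    Subtype.ext hbx, TensorProduct.zero_tmul]

open CategoryTheory in
lemma aux_exists_injective (R : Type u) [CommRing R] (M : Type u) [AddCommGroup M] [Module R M] :
    ∃ (E : ModuleCat.{u} R) (f : M →ₗ[R] E), Module.Injective R E ∧ Function.Injective f := by
  let E := Injective.under (ModuleCat.of R M)
  refine ⟨E, (Injective.ι (ModuleCat.of R M)).hom, ?_, ?_⟩
  · have : Injective (ModuleCat.of R E) := inferInstanceAs (Injective E)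
    exact Module.injective_module_of_injective_object R E
  · exact (ModuleCat.mono_iff_injective _).1 inferInstance

lemma aux_star_units {R : Type u} [CommRing R] (hd : ∀ x y : R, x ∣ y ∨ y ∣ x)
    (hu : ∀ z ∈ nonZeroDivisors R, IsUnit z) (hs : AuxStar R) (x : R) :
    ∃ b, ∀ t, t * x = 0 ↔ b ∣ t := by
  obtain ⟨r, a, hr, ha, har, h⟩ := hs
  refine aux_principal_ann hd hu r a hr ha (fun t => ⟨fun ht => ?_, ?_⟩) x
  · obtain ⟨z, hz, h⟩ := h t ht
    exact (hu z hz).dvd_mul_left.1 h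
  · rintro ⟨q, rfl⟩
    linear_combination q * har

lemma aux_semicoherent {R : Type u} [CommRing R] (hd : ∀ x y : R, x ∣ y ∨ y ∣ x)
    (hs : AuxStar R) : IsSemicoherentRing R := by
  have hinj : Function.Injective (algebraMap R (FractionRing R)) := IsFractionRing.injective R _
  have hunit : ∀ z ∈ nonZeroDivisors R, IsUnit (algebraMap R (FractionRing R) z) :=
    fun z hz => IsLocalization.map_units _ (⟨z, hz⟩ : nonZeroDivisors R)
  have hrep : ∀ x : FractionRing R, ∃ y : R, ∃ z : FractionRing R, IsUnit z ∧
      x = algebraMap R _ y * z := by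
    intro x
    obtain ⟨⟨y, s⟩, h⟩ := IsLocalization.surj (nonZeroDivisors R) x
    obtain ⟨w, hw⟩ := hunit s s.2
    refine ⟨y, ↑w⁻¹, w⁻¹.isUnit, ?_⟩
    rw [Units.eq_mul_inv_iff_mul_eq, hw]
    exact h
  have hdQ : ∀ x y : FractionRing R, x ∣ y ∨ y ∣ x := by
    intro x y
    obtain ⟨x, u, hu, rfl⟩ := hrep x
    obtain ⟨y, v, hv, rfl⟩ := hrep y
    rw [hu.mul_right_dvd, hv.dvd_mul_right, hv.mul_right_dvd, hu.dvd_mul_right]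
    exact (hd x y).imp (map_dvd _) (map_dvd _)
  have huQ : ∀ z ∈ nonZeroDivisors (FractionRing R), IsUnit z := by
    intro z hz
    obtain ⟨x, u, hu, rfl⟩ := hrep z
    refine (hunit x ?_).mul hu
    rw [mem_nonZeroDivisors_iff_right]
    intro t ht
    apply hinj
    rw [map_zero]
    refine (mem_nonZeroDivisors_iff_right.1 hz) _ ?_
    rw [← mul_assoc, ← map_mul, ht, map_zero, zero_mul]
  have hsQ : AuxStar (FractionRing R) := by
    obtain ⟨r, a, hr, ha, har, h⟩ := hs
    refine ⟨algebraMap R _ r, algebraMap R _ a, ?_, ?_, ?_, ?_⟩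
    · rwa [Ne, map_eq_zero_iff _ hinj]
    · rwa [Ne, map_eq_zero_iff _ hinj]
    · rw [← map_mul, har, map_zero]
    · intro t ht
      obtain ⟨x, u, hu, rfl⟩ := hrep t
      have hx : x * r = 0 := by
        apply hinj
        rw [map_zero, map_mul, ← hu.mul_left_eq_zero, ← ht]
        ring
      obtain ⟨z, hz, h⟩ := h x hx
      refine ⟨algebraMap R _ z, (hunit z hz).mem_nonZeroDivisors, ?_⟩
      rw [← mul_assoc, ← map_mul]
      exact (map_dvd _ h).mul_right u
  have hann := aux_star_units hdQ huQ hsQ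
  have hann2 : ∀ x : FractionRing R, ∃ b, (∀ t, t * x = 0 ↔ b ∣ t) ∧ ∀ t, t * b = 0 → x ∣ t := by
    intro x
    obtain ⟨b, hb⟩ := hann x
    refine ⟨b, hb, fun t ht => ?_⟩
    by_cases hx : x = 0
    · subst hx
      have : b ∣ 1 := (hb 1).1 (by simp)
      rw [(isUnit_of_dvd_one this).mul_left_eq_zero.1 ht]
    rcases aux_double hdQ x t hx (fun s hs => by
      obtain ⟨q, rfl⟩ := (hb s).1 hs
      linear_combination q * ht) with h | ⟨z, hz, rfl⟩
    · exact h
    · exact (huQ z hz).mul_right_dvd.2 dvd_rfl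
  intro E F _ _ _ _ hE hF
  let M := E →ₗ[R] F
  let MQ := LocalizedModule (nonZeroDivisors R) M
  let _ : Module (FractionRing R) MQ :=
    inferInstanceAs (Module (Localization (nonZeroDivisors R)) MQ)
  have : IsScalarTower R (FractionRing R) MQ :=
    inferInstanceAs (IsScalarTower R (Localization (nonZeroDivisors R)) MQ)
  obtain ⟨G, f, hG, hf⟩ := aux_exists_injective (FractionRing R) MQ
  let _ : Module R G := Module.compHom G (algebraMap R (FractionRing R))
  have : IsScalarTower R (FractionRing R) G := IsScalarTower.of_algebraMap_smul (fun _ _ => rfl)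
  have : Module.Flat (FractionRing R) G := aux_flat hdQ hann2 G (aux_pinj_of_inj hG)
  have : Module.Flat R (FractionRing R) := IsLocalization.flat _ (nonZeroDivisors R)
  have hflat : Module.Flat R G := Module.Flat.trans R (FractionRing R) G
  refine ⟨ModuleCat.of R G, hflat,
    (f.restrictScalars R) ∘ₗ (LocalizedModule.mkLinearMap (nonZeroDivisors R) M), ?_⟩
  rw [LinearMap.coe_comp]
  refine Function.Injective.comp hf ?_
  rw [injective_iff_map_eq_zero]
  intro g hg
  obtain ⟨u, hu, h⟩ := (aux_loc_zero (nonZeroDivisors R) g 1).1 hg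
  ext e
  obtain ⟨e', rfl⟩ := aux_pinj_of_inj hE u e (fun t ht => by
    rw [(mem_nonZeroDivisors_iff_right.1 hu) t ht, zero_smul])
  rw [map_smul]
  exact LinearMap.congr_fun h e'

lemma aux_star_of_semicoherent {R : Type u} [CommRing R] (hd : ∀ x y : R, x ∣ y ∨ y ∣ x)
    (hs : IsSemicoherentRing R) (r : R) (hr : r ≠ 0) (hrZ : r ∉ nonZeroDivisors R) :
    AuxStar R := by
  obtain ⟨E, j, hE, hj⟩ := aux_exists_injective R R
  obtain ⟨F, k, hF, hk⟩ := aux_exists_injective R (E ⧸ LinearMap.range (LinearMap.lsmul R E r))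
  obtain ⟨G, hG, i, hi⟩ := hs E F hE hF
  let f : E →ₗ[R] F := k ∘ₗ (LinearMap.range (LinearMap.lsmul R E r)).mkQ
  have hf : ∀ t : R, t • f = 0 ↔ ∀ e : E, ∃ e' : E, t • e = r • e' := by
    intro t
    rw [LinearMap.ext_iff]
    refine forall_congr' fun e => ?_
    rw [LinearMap.smul_apply, LinearMap.zero_apply, ← map_smul]
    simp only [f, LinearMap.comp_apply]
    rw [map_eq_zero_iff k hk, Submodule.mkQ_apply, Submodule.Quotient.mk_eq_zero]
    constructor
    · rintro ⟨e', h⟩; exact ⟨e', h.symm⟩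
    · rintro ⟨e', h⟩; exact ⟨e', h.symm⟩
  have hrf : r • f = 0 := (hf r).2 (fun e => ⟨e, rfl⟩)
  have hann : ∀ t : R, t • f = 0 → ∀ s, s * r = 0 → s * t = 0 := by
    intro t ht s hsr
    obtain ⟨e', he'⟩ := (hf t).1 ht (j 1)
    apply hj
    rw [map_zero, show s * t = s • t • (1 : R) by simp, map_smul, map_smul, he', ← mul_smul, hsr,
      zero_smul]
  have hrel : ∑ _l : Unit, r • i f = 0 := by simp [← map_smul, hrf]
  obtain ⟨κ, A, y, hxy, hA⟩ := Module.Flat.isTrivialRelation_of_sum_smul_eq_zero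
    (f := fun _ : Unit => r) (x := fun _ => i f) hrel
  have hxy' : i f = ∑ l, A () l • y l := hxy ()
  simp only [Finset.univ_unique, Finset.sum_singleton] at hA
  obtain ⟨a, ha⟩ := aux_fg_principal hd (Ideal.span (Set.range (A ())))
    ⟨(Set.finite_range (A ())).toFinset, by simp [Ideal.span]⟩
  have haA : ∀ l, a ∣ A () l := fun l => by
    rw [← Ideal.mem_span_singleton, ← ha]
    exact Ideal.subset_span ⟨l, rfl⟩
  have har : a * r = 0 := by
    have h1 : Ideal.span (Set.range (A ())) ≤ LinearMap.ker (LinearMap.lsmul R R r) := by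
      rw [Ideal.span_le]
      rintro _ ⟨l, rfl⟩
      exact hA l
    have h2 := h1 (show a ∈ _ by rw [ha]; exact Ideal.mem_span_singleton_self a)
    rw [mul_comm]
    exact h2
  have hta : ∀ t, t * a = 0 → ∀ s, s * r = 0 → s * t = 0 := by
    intro t ht
    refine hann t (hi ?_)
    rw [map_smul, map_zero, hxy', Finset.smul_sum]
    refine Finset.sum_eq_zero fun l _ => ?_
    obtain ⟨q, hq⟩ := haA l
    rw [hq, ← mul_smul, ← mul_assoc, ht, zero_mul, zero_smul]
  have ha0 : a ≠ 0 := by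
    rintro rfl
    apply hrZ
    rw [mem_nonZeroDivisors_iff_right]
    intro s hs
    simpa using hta 1 (by simp) s hs
  refine ⟨r, a, hr, ha0, har, fun t ht => ?_⟩
  rcases aux_double hd a t ha0 (fun s hs => by rw [mul_comm]; exact hta s hs t ht) with
    h | ⟨z, hz, h⟩
  · exact ⟨1, one_mem _, by rwa [one_mul]⟩
  · exact ⟨z, hz, by rw [h, mul_comm]⟩

lemma aux_chain_sup {R M : Type*} [CommRing R] [AddCommGroup M] [Module R M]
    (p : Submodule R M → Prop) (q : M → Prop)
    (hp : ∀ X, p X ↔ ∀ x ∈ X, q x) (X0 : Submodule R M) (h0 : p X0) :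
    ∃ X, X0 ≤ X ∧ p X ∧ ∀ Y, p Y → X ≤ Y → Y = X := by
  obtain ⟨X, hX, hmax⟩ := zorn_le_nonempty₀ {X | p X} (fun c hc hchain y hy =>
    ⟨sSup c, (hp _).2 (fun x hx => by
      rw [Submodule.mem_sSup_of_directed ⟨y, hy⟩ hchain.directedOn] at hx
      obtain ⟨z, hz, hxz⟩ := hx
      exact (hp z).1 (hc hz) x hxz), fun z hz => le_sSup hz⟩) X0 h0
  exact ⟨X, hX, hmax.1, fun Y hY h => le_antisymm (hmax.2 hY h) h⟩

lemma aux_exists_hull (R : Type u) [CommRing R] (M : Type u) [AddCommGroup M] [Module R M] :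
    ∃ (E : ModuleCat.{u} R) (f : M →ₗ[R] E), IsInjectiveHull R M E f := by
  obtain ⟨E0, f, hE0, hf⟩ := aux_exists_injective R M
  obtain ⟨E, hNE, hE, hEmax⟩ := aux_chain_sup
    (fun X : Submodule R E0 => ∀ x ∈ X, x ≠ 0 → ∃ r : R, r • x ∈ LinearMap.range f ∧ r • x ≠ 0)
    (fun x => x ≠ 0 → ∃ r : R, r • x ∈ LinearMap.range f ∧ r • x ≠ 0) (fun _ => Iff.rfl)
    (LinearMap.range f) (fun x hx h => ⟨1, by simpa using hx, by simpa using h⟩)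
  obtain ⟨C, -, hC, hCmax⟩ := aux_chain_sup
    (fun X : Submodule R E0 => ∀ x ∈ X, x ∈ E → x = 0)
    (fun x => x ∈ E → x = 0) (fun _ => Iff.rfl) ⊥ (fun x hx _ => by simpa using hx)
  obtain ⟨h, hh⟩ := hE0.out (C.mkQ ∘ₗ E.subtype) (by
    rw [injective_iff_map_eq_zero]
    intro e he
    have : (e : E0) ∈ C := by simpa using he
    exact Subtype.ext (hC e this e.2)) E.subtype
  let p : E0 →ₗ[R] E0 := h ∘ₗ C.mkQ
  have hpE : ∀ e ∈ E, p e = e := fun e he => hh ⟨e, he⟩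
  have hpC : ∀ c ∈ C, p c = 0 := fun c hc => by
    simp only [p, LinearMap.comp_apply]
    rw [show C.mkQ c = 0 by simpa using hc, map_zero]
  have hrange : LinearMap.range p = E := by
    refine hEmax _ ?_ (fun e he => ⟨e, hpE e he⟩)
    rintro _ ⟨w, rfl⟩ hy
    obtain ⟨x, hx, hxE, hx0⟩ : ∃ x, x ∈ Submodule.span R {p w} ∧ x ∈ E ∧ x ≠ 0 := by
      by_contra hcon
      push Not at hcon
      have := hCmax ((Submodule.span R {p w}).comap p) (fun x hx hxE => by
        rw [Submodule.mem_comap, hpE x hxE] at hx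
        exact hcon x hx hxE) (fun c hc => by
        rw [Submodule.mem_comap, hpC c hc]; exact zero_mem _)
      refine hy (hpC w ?_)
      rw [← this, Submodule.mem_comap]
      exact Submodule.mem_span_singleton_self _
    obtain ⟨r, rfl⟩ := Submodule.mem_span_singleton.1 hx
    obtain ⟨r', h1, h2⟩ := hE _ hxE hx0
    exact ⟨r' * r, by rwa [mul_smul], by rwa [mul_smul]⟩
  let π : E0 →ₗ[R] E := p.codRestrict E (fun x => by rw [← hrange]; exact ⟨x, rfl⟩)
  have hπ : ∀ e : E, π e = e := fun e => Subtype.ext (hpE e e.2)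
  refine ⟨ModuleCat.of R E, f.codRestrict E (fun x => hNE ⟨x, rfl⟩), ⟨?_⟩, ?_, ?_⟩
  · intro X Y _ _ _ _ i hi g
    obtain ⟨g', hg'⟩ := hE0.out i hi (E.subtype ∘ₗ g)
    refine ⟨π ∘ₗ g', fun x => ?_⟩
    rw [LinearMap.comp_apply, hg']
    exact hπ (g x)
  · intro x y hxy
    exact hf (congrArg Subtype.val hxy)
  · intro N hN
    rw [Submodule.ne_bot_iff] at hN ⊢
    obtain ⟨x, hx, hx0⟩ := hN
    obtain ⟨r, ⟨m, hm⟩, h2⟩ := hE x.1 x.2 (fun h => hx0 (Subtype.ext h))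
    exact ⟨r • x, ⟨N.smul_mem r hx, ⟨m, Subtype.ext hm⟩⟩, fun h => h2 (congrArg Subtype.val h)⟩
/-- Let `R` be a valuation ring with maximal ideal `P` and set of
zerodivisors the prime ideal `Z`.  TFAE: (1) `R` is coherent or not semicoherent;
(2) `S⁻¹E` is injective for every multiplicative subset `S` and every injective module `E`;
(3) `S⁻¹E` is FP-injective for every multiplicative subset `S` and every FP-injective
module `E`; (4) `(E_R(R/P))_Z` is FP-injective. -/
theorem valuationRing_tfae_localization_injective (R : Type u) [CommRing R]
    (hv : IsChainRing R) (P : Ideal R) (hP : P.IsMaximal)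
    (Z : Ideal R) (hZcar : ∀ r : R, r ∈ Z ↔ r ∉ nonZeroDivisors R) (hZprime : Z.IsPrime) :
    haveI := hZprime
    List.TFAE [
      IsCoherentRing R ∨ ¬ IsSemicoherentRing R,
      ∀ (S : Submonoid R) (E : Type u) [AddCommGroup E] [Module R E],
        Module.Injective R E → Module.Injective R (LocalizedModule S E),
      ∀ (S : Submonoid R) (E : Type u) [AddCommGroup E] [Module R E],
        IsFPInjective R E → IsFPInjective R (LocalizedModule S E),
      ∀ (E : Type u) [AddCommGroup E] [Module R E] (f : (R ⧸ P) →ₗ[R] E),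
        IsInjectiveHull R (R ⧸ P) E f →
          IsFPInjective R (LocalizedModule Z.primeCompl E)] := by
  have hd : ∀ x y : R, x ∣ y ∨ y ∣ x := fun x y => by
    rcases hv (Ideal.span {x}) (Ideal.span {y}) with h | h
    · exact Or.inr (Ideal.span_singleton_le_span_singleton.1 h)
    · exact Or.inl (Ideal.span_singleton_le_span_singleton.1 h)
  have hPu : ∀ x, x ∈ P ↔ ¬ IsUnit x := by
    intro x
    constructor
    · intro hx hu
      exact hP.ne_top (P.eq_top_of_isUnit_mem hx hu)
    · intro hx
      obtain ⟨M, hM, hxM⟩ := exists_max_ideal_of_mem_nonunits hx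
      rcases hv M P with h | h
      · exact h hxM
      · rwa [hP.eq_of_le hM.ne_top h]
  have key : (IsCoherentRing R ∨ ¬ IsSemicoherentRing R) → AuxStar R →
      ∀ z ∈ nonZeroDivisors R, IsUnit z := by
    rintro (h | h) hs
    · exact aux_units_of_coherent hd P hPu h hs
    · exact absurd (aux_semicoherent hd hs) h
  tfae_have 1 → 2 := by
    intro h1 S E _ _ hE
    exact aux_inj_loc hd S hE (aux_pinj_loc hd S (aux_pinj_of_inj hE) (key h1))
  tfae_have 1 → 3 := by
    intro h1 S E _ _ hE
    exact aux_fp_of_pinj hd (aux_pinj_loc hd S (aux_pinj_of_fp hE) (key h1))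
  tfae_have 2 → 4 := by
    intro h2 E _ _ f hf
    exact aux_fp_of_pinj hd (aux_pinj_of_inj (h2 _ E hf.1))
  tfae_have 3 → 4 := by
    intro h3 E _ _ f hf
    exact h3 _ E (aux_fp_of_pinj hd (aux_pinj_of_inj hf.1))
  tfae_have 4 → 1 := by
    intro h4
    by_contra hcon
    push Not at hcon
    obtain ⟨hnc, hsc⟩ := hcon
    have hex : ∃ r : R, r ≠ 0 ∧ r ∉ nonZeroDivisors R := by
      by_contra h
      push Not at h
      refine hnc (aux_coherent hd (fun x => ?_))
      by_cases hx : x = 0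
      · exact ⟨1, fun t => by simp [hx]⟩
      · refine ⟨0, fun t => ?_⟩
        rw [zero_dvd_iff]
        exact ⟨fun ht => (mem_nonZeroDivisors_iff_right.1 (h x hx)) t ht, fun ht => by simp [ht]⟩
    obtain ⟨r0, hr0, hr0Z⟩ := hex
    have hstar := aux_star_of_semicoherent hd hsc r0 hr0 hr0Z
    have hnu : ¬ ∀ z ∈ nonZeroDivisors R, IsUnit z := fun hu =>
      hnc (aux_coherent hd (aux_star_units hd hu hstar))
    push Not at hnu
    obtain ⟨z0, hz0, hz0u⟩ := hnu
    obtain ⟨r, a, hr, ha, har, hann⟩ := hstar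
    obtain ⟨E, f, hE⟩ := aux_exists_hull R (R ⧸ P)
    have hmemZ : ∀ z, z ∈ nonZeroDivisors R ↔ z ∈ Z.primeCompl := by
      intro z
      have := hZcar z
      rw [Ideal.mem_primeCompl_iff, this, not_not]
    let one : R ⧸ P := Submodule.Quotient.mk 1
    have hone : ∀ t : R, t • one = 0 ↔ t ∈ P := by
      intro t
      rw [← Submodule.Quotient.mk_smul, Submodule.Quotient.mk_eq_zero]
      simp
    obtain ⟨e, he⟩ : ∃ e : E, f one = a • e := by
      refine aux_pinj_of_inj hE.1 a (f one) (fun t ht => ?_)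
      rw [← map_smul, (hone t).2, map_zero]
      rw [hPu]
      intro hu
      exact ha (hu.mul_right_eq_zero.1 ht)
    have hPe : ∀ t ∈ P, t • a • e = 0 := fun t ht => by
      rw [← he, ← map_smul, (hone t).2 ht, map_zero]
    have hae : a • e ≠ 0 := by
      rw [← he]
      intro h
      have h1 : one = 0 := hE.2.1 (by rw [h, map_zero])
      have h2 : (1 : R) ∈ P := (hone 1).1 (by rw [h1, smul_zero])
      exact (hPu 1).1 h2 isUnit_one
    obtain ⟨x, hx⟩ := aux_pinj_of_fp (h4 E f hE) r (LocalizedModule.mk e 1) (by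
      intro t ht
      obtain ⟨z, hz, q, hq⟩ := hann t ht
      rw [LocalizedModule.smul'_mk, aux_loc_zero]
      refine ⟨z0 * z, (hmemZ _).1 (mul_mem hz0 hz), ?_⟩
      rw [← mul_smul, mul_assoc, hq, show z0 * (a * q) = q * (z0 * a) by ring, mul_smul, mul_smul,
        hPe z0 ((hPu z0).2 hz0u), smul_zero])
    induction x using LocalizedModule.induction_on with
    | h e' s =>
    rw [LocalizedModule.smul'_mk, LocalizedModule.mk_eq] at hx
    obtain ⟨u, hu⟩ := hx
    rw [one_smul] at hu
    have hus : (u * s : R) ∈ nonZeroDivisors R := (hmemZ _).2 (u * s).2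
    have hu' : (u * s : R) • e = u • r • e' := by
      rw [mul_smul]; exact hu
    have hkill : ∀ t : R, t * r = 0 → (t * (u * s)) • e = 0 := by
      intro t ht
      rw [mul_smul, hu', Submonoid.smul_def, ← mul_smul, ← mul_smul,
        show t * u * r = 0 by linear_combination (u : R) * ht, zero_smul]
    rcases hd (u * s : R) a with ⟨q, hq⟩ | ⟨q, hq⟩
    · refine hae ?_
      rw [hq, mul_comm]
      refine hkill q ((mem_nonZeroDivisors_iff_right.1 hus) _ ?_)
      rw [← har, hq]; ring
    · refine hr ((mem_nonZeroDivisors_iff_right.1 hus) r ?_)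
      rw [hq]; linear_combination q * har
  tfae_finish
end
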